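/- arXiv:0807.4302 — 5 statements merged into one kernel-verified Lean document; each statement's English description precedes it below -/
import Mathlib

section
/- Let R be a (not necessarily commutative) ring and let I and J be left ideals of R. Let R[u] be the polynomial ring in one central variable u over R, let C : R → R[u] be the constant-coefficient embedding, and let K be the left ideal of R[u] generated by the set {u·C(a) : a ∈ I} ∪ {(1−u)·C(b) : b ∈ J}. Then I ∩ J = {r ∈ R : C(r) ∈ K}; that is, I ∩ J equals the contraction of K back to R. -/
/-- Left ideals of `R[X]` generated by elements which evaluate into a left ideal `I` at a central
element `c` evaluate into `I`. -/
theorem Polynomial.eval_mem_of_mem_span {R : Type*} [Ring R] {I : Ideal R} {c : R}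
    (hc : ∀ a, Commute a c) {s : Set (Polynomial R)} (hs : ∀ p ∈ s, p.eval c ∈ I)
    {p : Polynomial R} (hp : p ∈ Ideal.span s) : p.eval c ∈ I := by
  have hle : Ideal.span s ≤ I.comap (Polynomial.eval₂RingHom' (RingHom.id R) c hc) :=
    Ideal.span_le.2 hs
  exact hle hp

/-- Lemma ("intersection"): for left ideals `I`, `J` of a (not necessarily
commutative) ring `R`, the intersection `I ∩ J` equals the contraction to `R`
(along the constant-coefficient embedding `C : R → R[u]`) of the left ideal of
`R[u]` generated by `{u·C(a) : a ∈ I} ∪ {(1−u)·C(b) : b ∈ J}`. -/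
theorem inf_eq_contraction_of_span {R : Type*} [Ring R] (I J : Ideal R) :
    ∀ r : R, r ∈ I ⊓ J ↔
      Polynomial.C r ∈
        Ideal.span
          ((fun a : R => Polynomial.X * Polynomial.C a) '' (I : Set R) ∪
            (fun b : R => (1 - Polynomial.X) * Polynomial.C b) '' (J : Set R)) := by
  intro r
  constructor
  · rintro ⟨hI, hJ⟩
    have hr : Polynomial.C r
        = Polynomial.X * Polynomial.C r + (1 - Polynomial.X) * Polynomial.C r := by
      rw [← add_mul, add_sub_cancel, one_mul]
    rw [hr]
    exact add_mem (Ideal.subset_span (Or.inl ⟨r, hI, rfl⟩))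
      (Ideal.subset_span (Or.inr ⟨r, hJ, rfl⟩))
  · intro hr
    constructor
    · simpa using Polynomial.eval_mem_of_mem_span (I := I) Commute.one_right (by
        rintro _ (⟨a, ha, rfl⟩ | ⟨b, -, rfl⟩)
        · simpa [Polynomial.X_mul_C] using ha
        · simp [sub_mul, Polynomial.X_mul_C]) hr
    · simpa using Polynomial.eval_mem_of_mem_span (I := J) Commute.zero_right (by
        rintro _ (⟨a, -, rfl⟩ | ⟨b, hb, rfl⟩)
        · simp [Polynomial.X_mul_C]
        · simpa [sub_mul, Polynomial.X_mul_C] using hb) hr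
end

section
/- Cayley's identity: let n ≥ 1, let R = ℚ[x_{ij} : 1 ≤ i,j ≤ n] be the polynomial ring in the n² entries of the generic n×n matrix M = (x_{ij}), and let f = det M ∈ R. Define the differential operator f(∂) = det(∂) := Σ_{τ ∈ S_n} sgn(τ) · ∂_{x_{1,τ(1)}}∘⋯∘∂_{x_{n,τ(n)}} acting ℚ-linearly on R. Then for every natural number m, det(∂)(f^{m+1}) = (m+1)(m+2)⋯(m+n) · f^m; equivalently, b(s)f^s = f(∂)f^{s+1} with b(s) = ∏_{i=1}^n (s+i). -/
open MvPolynomial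

/-- The generic `n × n` matrix `M = (x_{ij})` over the polynomial ring
`ℚ[x_{ij} : 1 ≤ i,j ≤ n]`. -/
noncomputable def genericMatrix (n : ℕ) :
    Matrix (Fin n) (Fin n) (MvPolynomial (Fin n × Fin n) ℚ) :=
  Matrix.of fun i j => X (i, j)

/-- The differential operator `det(∂) = Σ_{τ ∈ Sₙ} sgn(τ)·∂_{x_{1,τ(1)}}∘⋯∘∂_{x_{n,τ(n)}}`
acting on `ℚ[x_{ij}]` (the partial derivatives pairwise commute, so the order of
the fold is immaterial). -/
noncomputable def detPartial (n : ℕ) (p : MvPolynomial (Fin n × Fin n) ℚ) :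
    MvPolynomial (Fin n × Fin n) ℚ :=
  ∑ τ : Equiv.Perm (Fin n),
    ((Equiv.Perm.sign τ : ℤ) •
      (List.finRange n).foldl (fun q i => pderiv (i, τ i) q) p)

/-- The matrix `M` with each row `i < k` replaced by the unit vector `e_{τ i}`. -/
def unitRows {n : ℕ} {R : Type*} [CommRing R] (M : Matrix (Fin n) (Fin n) R)
    (τ : Equiv.Perm (Fin n)) (k : ℕ) : Matrix (Fin n) (Fin n) R :=
  Matrix.of fun i => if i.val < k then Pi.single (τ i) 1 else M i

section unitRows

variable {n : ℕ} {R : Type*} [CommRing R] (M : Matrix (Fin n) (Fin n) R)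
  (τ : Equiv.Perm (Fin n))

lemma unitRows_zero : unitRows M τ 0 = M := by
  ext i j
  simp [unitRows]

lemma unitRows_row_of_lt {k : ℕ} {i : Fin n} (h : i.val < k) :
    unitRows M τ k i = Pi.single (τ i) 1 := by
  exact if_pos h

lemma unitRows_row_of_le {k : ℕ} {i : Fin n} (h : k ≤ i.val) :
    unitRows M τ k i = M i := by
  exact if_neg (Nat.not_lt.mpr h)

lemma det_unitRows_self : (unitRows M τ n).det = ((Equiv.Perm.sign τ : ℤ) : R) := by
  rw [← Matrix.det_permutation (R := R) τ]
  congr 1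
  ext i j
  rw [unitRows_row_of_lt M τ i.isLt]
  simp [Equiv.Perm.permMatrix, PEquiv.toMatrix_apply, Pi.single_apply, eq_comm]

lemma updateRow_unitRows (k : Fin n) :
    (unitRows M τ k).updateRow k (Pi.single (τ k) 1) = unitRows M τ (k + 1) := by
  ext i j
  rcases lt_trichotomy i k with h | rfl | h
  · rw [Matrix.updateRow_ne h.ne, unitRows_row_of_lt M τ (Fin.lt_def.mp h),
      unitRows_row_of_lt M τ (by have := Fin.lt_def.mp h; omega)]
  · rw [Matrix.updateRow_self, unitRows_row_of_lt M τ (by omega)]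
  · rw [Matrix.updateRow_ne h.ne', unitRows_row_of_le M τ (Fin.lt_def.mp h).le,
      unitRows_row_of_le M τ (by have := Fin.lt_def.mp h; omega)]

lemma unitRows_mul_swap {j k : Fin n} (hjk : j < k) :
    unitRows M (τ * Equiv.swap j k) k =
      (unitRows M τ k).updateRow j (Pi.single (τ k) 1) := by
  ext i l
  by_cases hij : i = j
  · subst hij
    rw [Matrix.updateRow_self, unitRows_row_of_lt _ _ (Fin.lt_def.mp hjk)]
    simp
  · rw [Matrix.updateRow_ne hij]
    by_cases hik : i < k
    · rw [unitRows_row_of_lt _ _ (Fin.lt_def.mp hik), unitRows_row_of_lt _ _ (Fin.lt_def.mp hik),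
        Equiv.Perm.mul_apply, Equiv.swap_apply_of_ne_of_ne hij hik.ne]
    · rw [unitRows_row_of_le _ _ (Fin.le_def.mp (not_lt.mp hik)),
        unitRows_row_of_le _ _ (Fin.le_def.mp (not_lt.mp hik))]

/-- Cramer's rule expanding `w` in the rows of `B`, paired with a column of `adjugate M`. -/
lemma det_mul_sum_mul_adjugate (B : Matrix (Fin n) (Fin n) R) (w : Fin n → R) (k : Fin n) :
    B.det * ∑ c, w c * M.adjugate c k =
      ∑ i, (B.updateRow i w).det * (B * M.adjugate) i k := by
  have h := Matrix.mulVec_cramer B.transpose w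
  have h' : ∀ c, B.det * w c = ∑ i, B i c * (B.updateRow i w).det := fun c => by
    have := congrFun h c
    simp only [Matrix.mulVec, dotProduct, Matrix.transpose_apply, Matrix.det_transpose,
      Matrix.cramer_transpose_apply, Pi.smul_apply, smul_eq_mul] at this
    exact this.symm
  simp only [Finset.mul_sum, ← mul_assoc, h', Finset.sum_mul, Matrix.mul_apply]
  rw [Finset.sum_comm]
  refine Finset.sum_congr rfl fun i _ => Finset.sum_congr rfl fun c _ => by ring

lemma sum_sign_swap_adjugate_mul_det_unitRows (k : Fin n) :
    ∑ j ∈ Finset.Iic k, ((Equiv.Perm.sign (Equiv.swap j k) : ℤ) : R) *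
        (M.adjugate ((τ * Equiv.swap j k) k) k * (unitRows M (τ * Equiv.swap j k) k).det) =
      M.det * (unitRows M τ (k + 1)).det := by
  have h := det_mul_sum_mul_adjugate M (unitRows M τ k) (Pi.single (τ k) 1) k
  have hrow : ∀ i, (unitRows M τ k * M.adjugate) i k =
      if i < k then M.adjugate (τ i) k else if i = k then M.det else 0 := fun i => by
    split_ifs with h1 h2
    · simp [Matrix.mul_apply, unitRows_row_of_lt M τ (Fin.lt_def.mp h1), Pi.single_apply]
    · subst h2
      have := congrFun (congrFun (Matrix.mul_adjugate M) i) i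
      simpa [Matrix.mul_apply, unitRows_row_of_le M τ le_rfl] using this
    · have := congrFun (congrFun (Matrix.mul_adjugate M) i) k
      simpa [Matrix.mul_apply, unitRows_row_of_le M τ (Fin.le_def.mp (not_lt.mp h1)), h2]
        using this
  have hsum : ∑ i, ((unitRows M τ k).updateRow i (Pi.single (τ k) 1)).det *
      (unitRows M τ k * M.adjugate) i k =
      ∑ i ∈ Finset.Iio k, ((unitRows M τ k).updateRow i (Pi.single (τ k) 1)).det *
        M.adjugate (τ i) k + M.det * (unitRows M τ (k + 1)).det := by
    rw [← Finset.sum_subset (Finset.subset_univ (Finset.Iic k)), ← Finset.Iio_insert,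
      Finset.sum_insert (by simp), add_comm]
    · congr 1
      · refine Finset.sum_congr rfl fun i hi => ?_
        rw [hrow, if_pos (Finset.mem_Iio.mp hi)]
      · rw [hrow, updateRow_unitRows]
        simp [mul_comm]
    · intro i _ hi
      have hi' : k < i := by simpa using hi
      rw [hrow, if_neg hi'.not_gt, if_neg hi'.ne', mul_zero]
  rw [hsum] at h
  rw [← Finset.Iio_insert, Finset.sum_insert (by simp)]
  have hneg : ∑ j ∈ Finset.Iio k, ((Equiv.Perm.sign (Equiv.swap j k) : ℤ) : R) *
        (M.adjugate ((τ * Equiv.swap j k) k) k * (unitRows M (τ * Equiv.swap j k) k).det) =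
      -∑ i ∈ Finset.Iio k, ((unitRows M τ k).updateRow i (Pi.single (τ k) 1)).det *
        M.adjugate (τ i) k := by
    rw [← Finset.sum_neg_distrib]
    refine Finset.sum_congr rfl fun j hj => ?_
    have hj' := Finset.mem_Iio.mp hj
    rw [unitRows_mul_swap M τ hj', Equiv.Perm.sign_swap hj'.ne]
    simp [mul_comm]
  rw [hneg, Equiv.swap_self, ← Equiv.Perm.one_def, mul_one]
  simp [Pi.single_apply] at h ⊢
  linear_combination h

end unitRows

lemma Derivation.map_det_eq_zero {S A ι : Type*} [CommRing S] [CommRing A] [Algebra S A]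
    [Fintype ι] [DecidableEq ι] (D : Derivation S A A) (N : Matrix ι ι A)
    (h : ∀ i j, D (N i j) = 0) : D N.det = 0 := by
  have hprod : ∀ (s : Finset ι) (g : ι → A), (∀ i, D (g i) = 0) → D (∏ i ∈ s, g i) = 0 := by
    intro s g hg
    classical
    induction s using Finset.induction_on with
    | empty => simp
    | insert a s ha ih => rw [Finset.prod_insert ha, D.leibniz, ih, hg]; simp
  rw [Matrix.det_apply, map_sum]
  refine Finset.sum_eq_zero fun σ _ => ?_
  rw [Units.smul_def, map_zsmul, hprod _ _ fun i => h _ _, smul_zero]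

lemma pderiv_det_unitRows {n : ℕ} (τ : Equiv.Perm (Fin n)) (l : ℕ) (k c : Fin n) (hl : l ≤ k) :
    pderiv (k, c) (unitRows (genericMatrix n) τ l).det =
      (unitRows (genericMatrix n) τ l).adjugate c k := by
  have hadj : ∀ j, pderiv (k, c) ((unitRows (genericMatrix n) τ l).adjugate j k) = 0 := by
    intro j
    rw [Matrix.adjugate_apply]
    refine Derivation.map_det_eq_zero _ _ fun a b => ?_
    by_cases ha : a = k
    · subst ha
      rw [Matrix.updateRow_self, Pi.single_apply]
      split_ifs <;> simp
    · rw [Matrix.updateRow_ne ha]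
      by_cases hal : a.val < l
      · rw [unitRows_row_of_lt _ _ hal, Pi.single_apply]
        split_ifs <;> simp
      · rw [unitRows_row_of_le _ _ (not_lt.mp hal)]
        exact pderiv_X_of_ne fun h => ha (Prod.ext_iff.mp h).1
  rw [Matrix.det_eq_sum_mul_adjugate_row _ k, map_sum, Finset.sum_eq_single c]
  · rw [Derivation.leibniz, hadj, unitRows_row_of_le _ _ hl]
    simp [genericMatrix]
  · intro b _ hb
    rw [Derivation.leibniz, hadj, unitRows_row_of_le _ _ hl]
    simp [genericMatrix, pderiv_X_of_ne (show (k, b) ≠ (k, c) by simpa using hb)]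
  · simp

/-- Composition of the derivatives `∂_{x_{i,τ(i)}}` over `i` in a list. -/
noncomputable def pderivList {n : ℕ} (τ : Equiv.Perm (Fin n)) :
    List (Fin n) → MvPolynomial (Fin n × Fin n) ℚ →ₗ[ℚ] MvPolynomial (Fin n × Fin n) ℚ
  | [] => LinearMap.id
  | i :: L => pderivList τ L ∘ₗ (pderiv (i, τ i)).toLinearMap

lemma pderivList_apply {n : ℕ} (τ : Equiv.Perm (Fin n)) (L : List (Fin n))
    (p : MvPolynomial (Fin n × Fin n) ℚ) :
    pderivList τ L p = L.foldl (fun q i => pderiv (i, τ i) q) p := by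
  induction L generalizing p with
  | nil => rfl
  | cons i L ih => exact ih _

lemma pderivList_congr {n : ℕ} {τ τ' : Equiv.Perm (Fin n)} {L : List (Fin n)}
    (h : ∀ i ∈ L, τ i = τ' i) : pderivList τ L = pderivList τ' L := by
  induction L with
  | nil => rfl
  | cons i L ih =>
    rw [pderivList, pderivList, ih fun j hj => h j (List.mem_cons_of_mem _ hj),
      h i List.mem_cons_self]

/-- The alternating sum of the derivatives in the rows `≥ k`, applied to `f^m` times the
determinant of the generic matrix with its first `k` rows replaced by unit vectors. -/
noncomputable def cayleySum (n m k : ℕ) : MvPolynomial (Fin n × Fin n) ℚ :=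
  ∑ τ : Equiv.Perm (Fin n), (Equiv.Perm.sign τ : ℤ) •
    pderivList τ ((List.finRange n).drop k)
      ((genericMatrix n).det ^ m * (unitRows (genericMatrix n) τ k).det)

lemma lt_of_mem_drop_finRange {n : ℕ} (k : Fin n) {i : Fin n}
    (hi : i ∈ (List.finRange n).drop (k + 1)) : k < i := by
  obtain ⟨a, ha, rfl⟩ := List.mem_iff_getElem.mp hi
  simp [Fin.lt_def]
  omega

lemma pderivList_drop_mul_swap {n : ℕ} (τ : Equiv.Perm (Fin n)) {j k : Fin n} (hjk : j ≤ k) :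
    pderivList (τ * Equiv.swap j k) ((List.finRange n).drop (k + 1)) =
      pderivList τ ((List.finRange n).drop (k + 1)) :=
  pderivList_congr fun i hi => by
    have hi' := lt_of_mem_drop_finRange k hi
    rw [Equiv.Perm.mul_apply, Equiv.swap_apply_of_ne_of_ne (hjk.trans_lt hi').ne' hi'.ne']

lemma succ_nsmul_sum_sign_pderivList {n : ℕ} (k : Fin n)
    (g : MvPolynomial (Fin n × Fin n) ℚ) :
    ((k : ℕ) + 1) • ∑ τ : Equiv.Perm (Fin n), (Equiv.Perm.sign τ : ℤ) •
      pderivList τ ((List.finRange n).drop (k + 1))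
        (g * ((genericMatrix n).adjugate (τ k) k * (unitRows (genericMatrix n) τ k).det)) =
    ∑ τ : Equiv.Perm (Fin n), (Equiv.Perm.sign τ : ℤ) •
      pderivList τ ((List.finRange n).drop (k + 1))
        (g * ((genericMatrix n).det * (unitRows (genericMatrix n) τ (k + 1)).det)) := by
  have hcard : ∀ p : MvPolynomial (Fin n × Fin n) ℚ,
      ((k : ℕ) + 1) • p = ∑ _j ∈ Finset.Iic k, p := fun p => by
    rw [Finset.sum_const, Fin.card_Iic]
  rw [hcard, Finset.sum_congr rfl fun j _ => (Equiv.sum_comp (Equiv.mulRight (Equiv.swap j k)) _).symm,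
    Finset.sum_comm]
  refine Finset.sum_congr rfl fun τ _ => ?_
  rw [← sum_sign_swap_adjugate_mul_det_unitRows, Finset.mul_sum, map_sum, Finset.smul_sum]
  refine Finset.sum_congr rfl fun j hj => ?_
  rw [Equiv.coe_mulRight, pderivList_drop_mul_swap τ (Finset.mem_Iic.mp hj),
    Equiv.Perm.sign_mul, Units.val_mul, mul_smul, ← map_zsmul, ← zsmul_eq_mul, mul_smul_comm]

lemma cayleySum_succ {n : ℕ} (m : ℕ) (k : Fin n) :
    ((k : ℕ) + 1) • cayleySum n m k = (m + 1 + k) • cayleySum n m (k + 1) := by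
  have hstep : ∀ τ : Equiv.Perm (Fin n), pderivList τ ((List.finRange n).drop k)
      ((genericMatrix n).det ^ m * (unitRows (genericMatrix n) τ k).det) =
      pderivList τ ((List.finRange n).drop (k + 1))
        ((genericMatrix n).det ^ m * (unitRows (genericMatrix n) τ (k + 1)).det) +
      m • pderivList τ ((List.finRange n).drop (k + 1)) ((genericMatrix n).det ^ (m - 1) *
        ((genericMatrix n).adjugate (τ k) k * (unitRows (genericMatrix n) τ k).det)) := by
    intro τ
    have hdet := pderiv_det_unitRows τ 0 k (τ k) (Nat.zero_le _)
    rw [unitRows_zero] at hdet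
    rw [List.drop_eq_getElem_cons (by simp), pderivList, LinearMap.comp_apply, ← map_nsmul,
      ← map_add]
    congr 1
    simp only [List.getElem_finRange, Fin.cast_mk, Fin.eta, Derivation.coeFn_coe]
    rw [Derivation.leibniz, Derivation.leibniz_pow, hdet, pderiv_det_unitRows τ k k _ le_rfl,
      Matrix.adjugate_apply (unitRows _ _ _), updateRow_unitRows]
    simp only [smul_eq_mul, nsmul_eq_mul]
    ring
  have hpow : m • ∑ τ : Equiv.Perm (Fin n), (Equiv.Perm.sign τ : ℤ) •
      pderivList τ ((List.finRange n).drop (k + 1)) ((genericMatrix n).det ^ (m - 1) *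
        ((genericMatrix n).det * (unitRows (genericMatrix n) τ (k + 1)).det)) =
      m • cayleySum n m (k + 1) := by
    cases m with
    | zero => simp
    | succ m => simp only [cayleySum, Nat.add_sub_cancel, pow_succ, mul_assoc]
  rw [cayleySum]
  simp only [hstep, smul_add, Finset.sum_add_distrib, smul_comm _ m, ← Finset.smul_sum]
  rw [succ_nsmul_sum_sign_pderivList, hpow, ← cayleySum, ← add_smul]
  congr 1
  ring

lemma detPartial_det_pow_succ (n m : ℕ) :
    detPartial n ((genericMatrix n).det ^ (m + 1)) = cayleySum n m 0 := by
  simp [detPartial, cayleySum, unitRows_zero, pderivList_apply, pow_succ]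

lemma cayleySum_self (n m : ℕ) :
    cayleySum n m n = n.factorial • (genericMatrix n).det ^ m := by
  have hterm : ∀ τ : Equiv.Perm (Fin n), (Equiv.Perm.sign τ : ℤ) •
      pderivList τ ((List.finRange n).drop n)
        ((genericMatrix n).det ^ m * (unitRows (genericMatrix n) τ n).det) =
      (genericMatrix n).det ^ m := fun τ => by
    rw [List.drop_of_length_le (by simp), pderivList, LinearMap.id_apply, det_unitRows_self,
      mul_comm, ← zsmul_eq_mul, ← mul_smul, ← Units.val_mul, Int.units_mul_self,
      Units.val_one, one_smul]
  rw [cayleySum, Finset.sum_congr rfl fun τ _ => hterm τ, Finset.sum_const, Finset.card_univ,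
    Fintype.card_perm, Fintype.card_fin]

lemma factorial_nsmul_cayleySum_zero (n m k : ℕ) (hk : k ≤ n) :
    k.factorial • cayleySum n m 0 =
      (∏ i ∈ Finset.range k, (m + 1 + i)) • cayleySum n m k := by
  induction k with
  | zero => simp
  | succ k ih =>
    rw [Nat.factorial_succ, mul_smul, ih (by omega), Finset.prod_range_succ, mul_smul,
      smul_comm (k + 1), ← cayleySum_succ m ⟨k, hk⟩]

/-- Cayley's identity: `det(∂)(f^{m+1}) = (m+1)(m+2)⋯(m+n)·f^m` for
`f = det M` the generic determinant, i.e. `b(s)f^s = f(∂)f^{s+1}` with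
`b(s) = ∏_{i=1}^n (s+i)`. -/
theorem cayley_identity (n : ℕ) (hn : 1 ≤ n) (m : ℕ) :
    detPartial n ((genericMatrix n).det ^ (m + 1)) =
      MvPolynomial.C (((∏ k ∈ Finset.range n, (m + 1 + k) : ℕ) : ℚ)) *
        (genericMatrix n).det ^ m := by
  have h := factorial_nsmul_cayleySum_zero n m n le_rfl
  rw [cayleySum_self, smul_comm] at h
  have h' := nsmul_right_injective n.factorial_ne_zero h
  rw [detPartial_det_pow_succ, h', nsmul_eq_mul, map_natCast]
end

section
/- Let f₁ = x₁x₅ − x₂x₄, f₂ = x₂x₆ − x₃x₅, f₃ = x₃x₄ − x₁x₆ in ℚ[x₁,…,x₆] (the 2×2 minors of the generic 2×3 matrix). Then for all natural numbers m₁, m₂, m₃, writing σ = m₁+m₂+m₃, one has (σ+2)(σ+3)·f₁^{m₁}f₂^{m₂}f₃^{m₃} = f₁(∂)(f₁^{m₁+1}f₂^{m₂}f₃^{m₃}) + f₂(∂)(f₁^{m₁}f₂^{m₂+1}f₃^{m₃}) + f₃(∂)(f₁^{m₁}f₂^{m₂}f₃^{m₃+1}) in ℚ[x₁,…,x₆].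 -/
open MvPolynomial

/-- The iterated formal partial derivative `∂^β = ∂_{x₁}^{β₁}⋯∂_{x₆}^{β₆}`. -/
noncomputable def pdIter6 (β : Fin 6 → ℕ)
    (p : MvPolynomial (Fin 6) ℚ) : MvPolynomial (Fin 6) ℚ :=
  Finset.univ.toList.foldl (fun q i => (⇑(pderiv i))^[β i] q) p

/-- For `h = Σ_β c_β x^β ∈ ℚ[x₁,…,x₆]`, the differential operator
`h(∂) = Σ_β c_β ∂^β` obtained by replacing each variable by the corresponding
formal partial derivative, applied to `p`. -/
noncomputable def diffOp6 (h p : MvPolynomial (Fin 6) ℚ) :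
    MvPolynomial (Fin 6) ℚ :=
  ∑ β ∈ h.support, MvPolynomial.C (h.coeff β) * pdIter6 (⇑β) p

/-- Partial derivatives of a multivariate polynomial commute. -/
theorem pderiv_pderiv_comm {σ R : Type*} [CommRing R] (i j : σ) (p : MvPolynomial σ R) :
    pderiv i (pderiv j p) = pderiv j (pderiv i p) := by
  have h : ⁅pderiv (R := R) i, pderiv (R := R) j⁆ = 0 := by
    classical
    refine MvPolynomial.derivation_ext fun k => ?_
    rw [Derivation.commutator_apply]
    simp only [pderiv_X, Pi.single_apply]
    split_ifs <;> simp
  have h' := DFunLike.congr_fun h p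
  rw [Derivation.commutator_apply] at h'
  exact sub_eq_zero.mp h'

theorem pderiv_comm_iterate {σ R : Type*} [CommRing R] (i j : σ) (n : ℕ) (p : MvPolynomial σ R) :
    pderiv i ((⇑(pderiv j))^[n] p) = (⇑(pderiv j))^[n] (pderiv i p) :=
  (Function.Commute.iterate_right (f := ⇑(pderiv i)) (g := ⇑(pderiv j))
    (fun q => pderiv_pderiv_comm i j q) n) p

theorem foldl_pderiv_add_single {σ R : Type*} [CommRing R] [DecidableEq σ] (a : σ) (β : σ → ℕ)
    (l : List σ) (hl : l.Nodup) (p : MvPolynomial σ R) :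
    l.foldl (fun q i => (⇑(pderiv i))^[(β + Pi.single a 1 : σ → ℕ) i] q) p =
      l.foldl (fun q i => (⇑(pderiv i))^[β i] q) (if a ∈ l then pderiv a p else p) := by
  induction l generalizing p with
  | nil => simp
  | cons i l ih =>
    obtain ⟨hi, hl⟩ := List.nodup_cons.mp hl
    rw [List.foldl_cons, List.foldl_cons, ih hl]
    by_cases h : a = i
    · subst h
      simp [hi, Function.iterate_succ_apply]
    · by_cases h' : a ∈ l
      · simp [h, h', Ne.symm h, pderiv_comm_iterate]
      · simp [h, h', Ne.symm h]

theorem pdIter6_add_single (a : Fin 6) (β : Fin 6 → ℕ) (p : MvPolynomial (Fin 6) ℚ) :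
    pdIter6 (β + Pi.single a 1) p = pdIter6 β (pderiv a p) := by
  rw [pdIter6, foldl_pderiv_add_single _ _ _ (Finset.nodup_toList _), pdIter6]
  simp

theorem pdIter6_zero (p : MvPolynomial (Fin 6) ℚ) : pdIter6 0 p = p := by
  simp [pdIter6]

theorem diffOp6_eq_sum (h p : MvPolynomial (Fin 6) ℚ) {s : Finset (Fin 6 →₀ ℕ)}
    (hs : h.support ⊆ s) : diffOp6 h p = ∑ β ∈ s, C (h.coeff β) * pdIter6 (⇑β) p := by
  refine Finset.sum_subset hs fun β _ hβ => ?_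
  rw [notMem_support_iff.mp hβ, C_0, zero_mul]

theorem diffOp6_sub (g h p : MvPolynomial (Fin 6) ℚ) :
    diffOp6 (g - h) p = diffOp6 g p - diffOp6 h p := by
  classical
  rw [diffOp6_eq_sum (g - h) p (support_sub (Fin 6) g h),
    diffOp6_eq_sum g p Finset.subset_union_left,
    diffOp6_eq_sum h p Finset.subset_union_right, ← Finset.sum_sub_distrib]
  exact Finset.sum_congr rfl fun β _ => by rw [coeff_sub, C_sub, sub_mul]

theorem diffOp6_X_mul_X (a b : Fin 6) (p : MvPolynomial (Fin 6) ℚ) :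
    diffOp6 (X a * X b) p = pderiv a (pderiv b p) := by
  classical
  have h : (X a * X b : MvPolynomial (Fin 6) ℚ) =
      monomial (Finsupp.single a 1 + Finsupp.single b 1) 1 := by
    simp [X, monomial_mul]
  rw [h, diffOp6_eq_sum _ p support_monomial_subset, Finset.sum_singleton, coeff_monomial,
    if_pos rfl, C_1, one_mul, Finsupp.coe_add, Finsupp.single_eq_pi_single,
    Finsupp.single_eq_pi_single, pdIter6_add_single, ← zero_add (Pi.single a 1 : Fin 6 → ℕ),
    pdIter6_add_single, pdIter6_zero]

theorem Derivation.pow_of_eigenvector {R A : Type*} [CommRing R] [CommRing A] [Algebra R A]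
    (D : Derivation R A A) {f c : A} (hf : D f = c * f) (n : ℕ) :
    D (f ^ n) = n * c * f ^ n := by
  induction n with
  | zero => simp
  | succ n ih =>
    rw [pow_succ, D.leibniz, ih, hf, smul_eq_mul, smul_eq_mul]
    push_cast
    ring

theorem Derivation.prod_pow_of_eigenvectors {R A : Type*} [CommRing R] [CommRing A] [Algebra R A]
    (D : Derivation R A A) {f g h c : A} (hf : D f = c * f) (hg : D g = c * g) (hh : D h = c * h)
    (k m n : ℕ) :
    D (f ^ k * g ^ m * h ^ n) = ((k + m + n : ℕ) : A) * c * (f ^ k * g ^ m * h ^ n) := by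
  simp only [D.leibniz, D.pow_of_eigenvector hf, D.pow_of_eigenvector hg,
    D.pow_of_eigenvector hh, smul_eq_mul]
  push_cast
  ring

/-- The Capelli-type identity for the `2 × 3` matrix with rows `(x₀, x₁, x₂)`, `(x₃, x₄, x₅)`,
applied to a polynomial `G` on which the polarization operators act as on a product of `s`
maximal minors. -/
theorem minors_operator_identity (G s : MvPolynomial (Fin 6) ℚ) (hs : ∀ i, pderiv i s = 0)
    (h₁₁ : X 0 * pderiv 0 G + X 1 * pderiv 1 G + X 2 * pderiv 2 G = s * G)
    (h₂₂ : X 3 * pderiv 3 G + X 4 * pderiv 4 G + X 5 * pderiv 5 G = s * G)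
    (h₂₁ : X 3 * pderiv 0 G + X 4 * pderiv 1 G + X 5 * pderiv 2 G = 0) :
    (s + 2) * (s + 3) * G =
      diffOp6 (X 0 * X 4 - X 1 * X 3) ((X 0 * X 4 - X 1 * X 3) * G) +
        diffOp6 (X 1 * X 5 - X 2 * X 4) ((X 1 * X 5 - X 2 * X 4) * G) +
        diffOp6 (X 2 * X 3 - X 0 * X 5) ((X 2 * X 3 - X 0 * X 5) * G) := by
  have d0 := congrArg (pderiv 0) h₂₂
  have d1 := congrArg (pderiv 1) h₂₂
  have d2 := congrArg (pderiv 2) h₂₂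
  have d3 := congrArg (pderiv 3) h₂₁
  have d4 := congrArg (pderiv 4) h₂₁
  have d5 := congrArg (pderiv 5) h₂₁
  simp only [diffOp6_sub, diffOp6_X_mul_X, map_add, map_sub, map_zero, Derivation.leibniz, hs,
    pderiv_X, Pi.single_apply, smul_eq_mul, Fin.reduceEq, if_true, if_false,
    Derivation.map_one_eq_zero]
    at d0 d1 d2 d3 d4 d5 ⊢
  simp only [pderiv_pderiv_comm 3 _ G] at d3
  simp only [pderiv_pderiv_comm 4 _ G] at d4
  simp only [pderiv_pderiv_comm 5 _ G] at d5
  linear_combination -(X 0 * d0 + X 1 * d1 + X 2 * d2) + (X 0 * d3 + X 1 * d4 + X 2 * d5)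
    - (s + 3) * h₁₁ - 2 * h₂₂

/-- Example (ii): for the `2×2` minors `f₁ = x₁x₅ − x₂x₄`, `f₂ = x₂x₆ − x₃x₅`,
`f₃ = x₃x₄ − x₁x₆` of the generic `2×3` matrix, the functional equation
`(σ+2)(σ+3)·f₁^{m₁}f₂^{m₂}f₃^{m₃}
  = f₁(∂)(f₁^{m₁+1}f₂^{m₂}f₃^{m₃}) + f₂(∂)(f₁^{m₁}f₂^{m₂+1}f₃^{m₃})
    + f₃(∂)(f₁^{m₁}f₂^{m₂}f₃^{m₃+1})`
holds for all `m₁, m₂, m₃ ∈ ℕ`, where `σ = m₁+m₂+m₃`. -/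
theorem minors_functional_equation (m₁ m₂ m₃ : ℕ) :
    (MvPolynomial.C ((((m₁ + m₂ + m₃ : ℕ) : ℚ) + 2) * (((m₁ + m₂ + m₃ : ℕ) : ℚ) + 3)) *
        ((X 0 * X 4 - X 1 * X 3 : MvPolynomial (Fin 6) ℚ) ^ m₁ *
          (X 1 * X 5 - X 2 * X 4) ^ m₂ * (X 2 * X 3 - X 0 * X 5) ^ m₃)) =
      diffOp6 (X 0 * X 4 - X 1 * X 3)
          ((X 0 * X 4 - X 1 * X 3) ^ (m₁ + 1) * (X 1 * X 5 - X 2 * X 4) ^ m₂ *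
            (X 2 * X 3 - X 0 * X 5) ^ m₃) +
        diffOp6 (X 1 * X 5 - X 2 * X 4)
          ((X 0 * X 4 - X 1 * X 3) ^ m₁ * (X 1 * X 5 - X 2 * X 4) ^ (m₂ + 1) *
            (X 2 * X 3 - X 0 * X 5) ^ m₃) +
        diffOp6 (X 2 * X 3 - X 0 * X 5)
          ((X 0 * X 4 - X 1 * X 3) ^ m₁ * (X 1 * X 5 - X 2 * X 4) ^ m₂ *
            (X 2 * X 3 - X 0 * X 5) ^ (m₃ + 1)) := by
  have key (i j k l m n : Fin 6) (c : MvPolynomial (Fin 6) ℚ) (hf) (hg) (hh) :=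
    Derivation.prod_pow_of_eigenvectors
      (((X i : MvPolynomial (Fin 6) ℚ) • pderiv l + (X j : MvPolynomial (Fin 6) ℚ) • pderiv m +
        (X k : MvPolynomial (Fin 6) ℚ) • pderiv n :
        Derivation ℚ (MvPolynomial (Fin 6) ℚ) (MvPolynomial (Fin 6) ℚ)))
      (f := X 0 * X 4 - X 1 * X 3) (g := X 1 * X 5 - X 2 * X 4) (h := X 2 * X 3 - X 0 * X 5)
      (c := c) hf hg hh m₁ m₂ m₃
  have h₁₁ := key 0 1 2 0 1 2 1
  have h₂₂ := key 3 4 5 3 4 5 1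
  have h₂₁ := key 3 4 5 0 1 2 0
  simp only [Derivation.add_apply, Derivation.smul_apply, smul_eq_mul, mul_one, mul_zero,
    zero_mul] at h₁₁ h₂₂ h₂₁
  have hG := minors_operator_identity _ ((m₁ + m₂ + m₃ : ℕ) : MvPolynomial (Fin 6) ℚ)
    (fun i => Derivation.map_natCast _ _)
    (h₁₁ ?_ ?_ ?_) (h₂₂ ?_ ?_ ?_) (h₂₁ ?_ ?_ ?_)
  · convert hG using 1
    · rw [C_mul, C_add, C_add, map_natCast, map_ofNat, map_ofNat]
    · congr 1
      · congr 1 <;> congr 1 <;> ring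
      · congr 1; ring
  all_goals
    simp only [map_sub, Derivation.leibniz, pderiv_X, Pi.single_apply, smul_eq_mul,
      Fin.reduceEq, if_true, if_false]
    ring
end

section
/- Let f = x² + y³ in ℚ[x,y]. For every b ∈ ℚ[s], b satisfies the Bernstein–Sato functional equation for the pair (f, 1) if and only if (s + 5/6)(s + 1)(s + 7/6) divides b in ℚ[s]; that is, b_f(s) = (s + 5/6)(s + 1)(s + 7/6). -/
open MvPolynomial Polynomial

/-- The iterated formal partial derivative `∂^α = ∏ᵢ ∂_{xᵢ}^{αᵢ}` applied to a
multivariate polynomial (the partial derivatives pairwise commute, so the order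
of the fold is immaterial). -/
noncomputable def pdIter {σ : Type*} [Fintype σ] (α : σ → ℕ)
    (p : MvPolynomial σ ℚ) : MvPolynomial σ ℚ :=
  Finset.univ.toList.foldl (fun q i => (⇑(MvPolynomial.pderiv i))^[α i] q) p

/-- `b ∈ ℚ[s]` satisfies the Bernstein–Sato functional equation for the pair
`(f, g)`: there are finitely many multi-indices `α` and polynomials
`p_α ∈ (ℚ[x])[s]` with `b(m)·g·f^m = Σ_α p_α(m)·∂^α(g·f^(m+1))` for all `m ∈ ℕ`. -/
def SatisfiesBS {σ : Type*} [Fintype σ] (f g : MvPolynomial σ ℚ)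
    (b : Polynomial ℚ) : Prop :=
  ∃ (A : Finset (σ → ℕ)) (p : (σ → ℕ) → Polynomial (MvPolynomial σ ℚ)),
    ∀ m : ℕ,
      MvPolynomial.C (Polynomial.eval (m : ℚ) b) * g * f ^ m =
        ∑ α ∈ A, Polynomial.eval ((m : ℕ) : MvPolynomial σ ℚ) (p α) *
          pdIter α (g * f ^ (m + 1))

section Cusp

/-- The moments of `e^{-x²}` on the real line, normalised to have value `1` at `1`. -/
def momentX : ℕ → ℚ
  | 0 => 1
  | 1 => 0
  | n + 2 => (n + 1) / 2 * momentX n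

/-- Rational solutions of the recursion satisfied by the moments of `e^{-y³}`,
with prescribed values `p` at `1` and `q` at `y`. -/
def momentY (p q : ℚ) : ℕ → ℚ
  | 0 => p
  | 1 => q
  | 2 => 0
  | n + 3 => (n + 1) / 3 * momentY p q n

theorem exists_of_momentX_ne_zero : ∀ i : ℕ, momentX i ≠ 0 → ∃ a : ℕ, i = 2 * a
  | 0, _ => ⟨0, rfl⟩
  | 1, h => absurd rfl h
  | n + 2, h => by
    obtain ⟨a, rfl⟩ := exists_of_momentX_ne_zero n (right_ne_zero_of_mul h)
    exact ⟨a + 1, by ring⟩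

theorem exists_of_momentY_one_zero_ne_zero :
    ∀ j : ℕ, momentY 1 0 j ≠ 0 → ∃ a : ℕ, j = 3 * a
  | 0, _ => ⟨0, rfl⟩
  | 1, h => absurd rfl h
  | 2, h => absurd rfl h
  | n + 3, h => by
    obtain ⟨a, rfl⟩ := exists_of_momentY_one_zero_ne_zero n (right_ne_zero_of_mul h)
    exact ⟨a + 1, by ring⟩

theorem exists_of_momentY_zero_one_ne_zero :
    ∀ j : ℕ, momentY 0 1 j ≠ 0 → ∃ a : ℕ, j = 3 * a + 1
  | 0, h => absurd rfl h
  | 1, _ => ⟨0, rfl⟩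
  | 2, h => absurd rfl h
  | n + 3, h => by
    obtain ⟨a, rfl⟩ := exists_of_momentY_zero_one_ne_zero n (right_ne_zero_of_mul h)
    exact ⟨a + 1, by ring⟩

/-- The cusp polynomial `x² + y³`. -/
noncomputable abbrev cusp : MvPolynomial (Fin 2) ℚ := MvPolynomial.X 0 ^ 2 + MvPolynomial.X 1 ^ 3

/-- The linear functional `xⁱ yʲ ↦ momentX i * momentY p q j`, an algebraic model of
integration against `e^{-(x² + y³)}`. -/
noncomputable def cuspIntegral (p q : ℚ) : MvPolynomial (Fin 2) ℚ →ₗ[ℚ] ℚ :=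
  (MvPolynomial.basisMonomials (Fin 2) ℚ).constr ℚ fun d => momentX (d 0) * momentY p q (d 1)

theorem cuspIntegral_monomial (p q : ℚ) (d : Fin 2 →₀ ℕ) (a : ℚ) :
    cuspIntegral p q (MvPolynomial.monomial d a) = a * (momentX (d 0) * momentY p q (d 1)) := by
  have h : MvPolynomial.monomial d a = a • MvPolynomial.basisMonomials (Fin 2) ℚ d := by
    simp [MvPolynomial.smul_monomial]
  rw [h, map_smul, cuspIntegral, Module.Basis.constr_basis, smul_eq_mul]

theorem pderiv_zero_cusp :
    MvPolynomial.pderiv 0 cusp = MvPolynomial.monomial (Finsupp.single 0 1) 2 := by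
  rw [← MvPolynomial.C_mul_X_eq_monomial]
  simp [cusp, MvPolynomial.pderiv_X, Derivation.leibniz_pow, map_ofNat]

theorem pderiv_one_cusp :
    MvPolynomial.pderiv 1 cusp = MvPolynomial.monomial (Finsupp.single 1 2) 3 := by
  rw [← MvPolynomial.C_mul_X_pow_eq_monomial]
  simp [cusp, MvPolynomial.pderiv_X, Derivation.leibniz_pow, map_ofNat]

theorem cuspIntegral_pderiv (p q : ℚ) (i : Fin 2) (g : MvPolynomial (Fin 2) ℚ) :
    cuspIntegral p q (MvPolynomial.pderiv i g) =
      cuspIntegral p q (MvPolynomial.pderiv i cusp * g) := by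
  induction g using MvPolynomial.induction_on' with
  | add g h hg hh => simp only [map_add, mul_add, hg, hh]
  | monomial d a =>
    rw [MvPolynomial.pderiv_monomial]
    fin_cases i
    · simp only [Fin.zero_eta, Fin.isValue, pderiv_zero_cusp, MvPolynomial.monomial_mul,
        cuspIntegral_monomial]
      rcases hd : d 0 with _ | n
      · simp [hd, momentX]
      · simp [hd, show 1 + (n + 1) = n + 2 by ring, momentX]
        ring
    · simp only [Fin.mk_one, Fin.isValue, pderiv_one_cusp, MvPolynomial.monomial_mul,
        cuspIntegral_monomial]
      rcases hd : d 1 with _ | n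
      · simp [hd, momentY]
      · simp [hd, show 2 + (n + 1) = n + 3 by ring, momentY]
        ring

/-- The weighted Euler field `3x∂ₓ + 2y∂ᵧ`. -/
noncomputable def cuspEuler : Derivation ℚ (MvPolynomial (Fin 2) ℚ) (MvPolynomial (Fin 2) ℚ) :=
  (3 * MvPolynomial.X 0 : MvPolynomial (Fin 2) ℚ) • MvPolynomial.pderiv 0 +
    (2 * MvPolynomial.X 1 : MvPolynomial (Fin 2) ℚ) • MvPolynomial.pderiv 1

theorem cuspEuler_apply (g : MvPolynomial (Fin 2) ℚ) :
    cuspEuler g = 3 * MvPolynomial.X 0 * MvPolynomial.pderiv 0 g +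
      2 * MvPolynomial.X 1 * MvPolynomial.pderiv 1 g := rfl

theorem Derivation.map_ofNat {R A : Type*} [CommSemiring R] [CommSemiring A] [Algebra R A]
    (D : Derivation R A A) (n : ℕ) [n.AtLeastTwo] : D (ofNat(n) : A) = 0 :=
  D.map_natCast n

theorem Derivation.pow_eigenvector {R A : Type*} [CommRing R] [CommRing A] [Algebra R A]
    (D : Derivation R A A) {a : A} {k : A} (h : D a = k * a) (n : ℕ) :
    D (a ^ n) = n * k * a ^ n := by
  induction n with
  | zero => simp
  | succ n ih =>
    rw [pow_succ, D.leibniz, ih, h]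
    simp only [smul_eq_mul]
    push_cast
    ring

theorem cuspEuler_monomial_mul_pow (d : Fin 2 →₀ ℕ) (a : ℚ) (m : ℕ) :
    cuspEuler (MvPolynomial.monomial d a * cusp ^ m) =
      (3 * d 0 + 2 * d 1 + 6 * m) * (MvPolynomial.monomial d a * cusp ^ m) := by
  have hx : cuspEuler (MvPolynomial.X 0) = 3 * MvPolynomial.X 0 := by
    simp [cuspEuler_apply, MvPolynomial.pderiv_X]
  have hy : cuspEuler (MvPolynomial.X 1) = 2 * MvPolynomial.X 1 := by
    simp [cuspEuler_apply, MvPolynomial.pderiv_X]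
  have hf : cuspEuler cusp = 6 * cusp := by
    rw [cusp, map_add, Derivation.pow_eigenvector _ hx, Derivation.pow_eigenvector _ hy]
    push_cast
    ring
  have hC : cuspEuler (MvPolynomial.C a) = 0 := by simp
  rw [MvPolynomial.monomial_eq, Finsupp.prod_fintype _ _ (by simp), Fin.prod_univ_two]
  simp only [Derivation.leibniz, Derivation.pow_eigenvector _ hx,
    Derivation.pow_eigenvector _ hy, Derivation.pow_eigenvector _ hf, hC, smul_eq_mul]
  ring

theorem cuspIntegral_cusp_mul (p q : ℚ) (g : MvPolynomial (Fin 2) ℚ) :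
    6 * cuspIntegral p q (cusp * g) = cuspIntegral p q (5 * g + cuspEuler g) := by
  have hx := cuspIntegral_pderiv p q 0 (3 * (MvPolynomial.X 0 * g))
  have hy := cuspIntegral_pderiv p q 1 (2 * (MvPolynomial.X 1 * g))
  have e : 5 * g + cuspEuler g = MvPolynomial.pderiv 0 (3 * (MvPolynomial.X 0 * g)) +
      MvPolynomial.pderiv 1 (2 * (MvPolynomial.X 1 * g)) := by
    simp only [Derivation.leibniz, MvPolynomial.pderiv_X_self, cuspEuler_apply, smul_eq_mul,
      Derivation.map_ofNat]
    ring
  rw [e, map_add, hx, hy, ← map_add, ← smul_eq_mul, ← map_smul]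
  congr 1
  rw [pderiv_zero_cusp, pderiv_one_cusp, ← MvPolynomial.C_mul_X_eq_monomial,
    ← MvPolynomial.C_mul_X_pow_eq_monomial, MvPolynomial.smul_eq_C_mul]
  simp only [map_ofNat]
  ring

theorem cuspIntegral_monomial_mul_pow (p q : ℚ) (d : Fin 2 →₀ ℕ) (a : ℚ) (m : ℕ) :
    cuspIntegral p q (MvPolynomial.monomial d a * cusp ^ m) =
      (∏ k ∈ Finset.range m, ((5 / 6 + d 0 / 2 + d 1 / 3 : ℚ) + k)) *
        (a * (momentX (d 0) * momentY p q (d 1))) := by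
  induction m with
  | zero => simp [cuspIntegral_monomial]
  | succ m ih =>
    have h := cuspIntegral_cusp_mul p q (MvPolynomial.monomial d a * cusp ^ m)
    have e : 5 * (MvPolynomial.monomial d a * cusp ^ m) +
        (3 * d 0 + 2 * d 1 + 6 * m) * (MvPolynomial.monomial d a * cusp ^ m) =
        (5 + 3 * d 0 + 2 * d 1 + 6 * m : ℚ) • (MvPolynomial.monomial d a * cusp ^ m) := by
      rw [MvPolynomial.smul_eq_C_mul]
      simp only [map_add, map_mul, map_ofNat, map_natCast]
      ring
    rw [cuspEuler_monomial_mul_pow, e, map_smul, ih, smul_eq_mul] at h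
    rw [show MvPolynomial.monomial d a * cusp ^ (m + 1) =
      cusp * (MvPolynomial.monomial d a * cusp ^ m) by ring, Finset.prod_range_succ]
    linear_combination h / 6

/-- All moments `E (h * g m)` of the sequence `g` are polynomial multiples of the rising
factorial `c (c + 1) ⋯ (c + m)`. -/
def HasFactorialMoments (E : MvPolynomial (Fin 2) ℚ →ₗ[ℚ] ℚ) (c : ℚ)
    (g : ℕ → MvPolynomial (Fin 2) ℚ) : Prop :=
  ∀ h : MvPolynomial (Fin 2) ℚ, ∃ Q : Polynomial ℚ, ∀ m : ℕ,
    E (h * g m) = (∏ k ∈ Finset.range (m + 1), (c + k)) * Q.eval (m : ℚ)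

theorem HasFactorialMoments.pderiv {p q c : ℚ} {g : ℕ → MvPolynomial (Fin 2) ℚ}
    (hg : HasFactorialMoments (cuspIntegral p q) c g) (i : Fin 2) :
    HasFactorialMoments (cuspIntegral p q) c fun m => MvPolynomial.pderiv i (g m) := by
  intro h
  obtain ⟨Q, hQ⟩ := hg (MvPolynomial.pderiv i cusp * h)
  obtain ⟨Q', hQ'⟩ := hg (MvPolynomial.pderiv i h)
  refine ⟨Q - Q', fun m => ?_⟩
  have e : h * MvPolynomial.pderiv i (g m) =
      MvPolynomial.pderiv i (h * g m) - MvPolynomial.pderiv i h * g m := by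
    simp only [Derivation.leibniz, smul_eq_mul]
    ring
  rw [e, map_sub, cuspIntegral_pderiv, ← mul_assoc, hQ, hQ', Polynomial.eval_sub]
  ring

/-- A property of sequences stable under partial derivatives is stable under `pdIter`. -/
theorem pdIter_induction {P : (ℕ → MvPolynomial (Fin 2) ℚ) → Prop}
    (hP : ∀ g i, P g → P fun m => MvPolynomial.pderiv i (g m)) (α : Fin 2 → ℕ)
    {g : ℕ → MvPolynomial (Fin 2) ℚ} (hg : P g) : P fun m => pdIter α (g m) := by
  simp only [pdIter]
  generalize (Finset.univ : Finset (Fin 2)).toList = l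
  induction l generalizing g with
  | nil => exact hg
  | cons i l ih =>
    refine ih (g := fun m => (⇑(MvPolynomial.pderiv i))^[α i] (g m)) ?_
    induction α i with
    | zero => exact hg
    | succ n ihn =>
      simp only [Function.iterate_succ_apply']
      exact hP _ i ihn

theorem HasFactorialMoments.eval_mul {E : MvPolynomial (Fin 2) ℚ →ₗ[ℚ] ℚ} {c : ℚ}
    {g : ℕ → MvPolynomial (Fin 2) ℚ} (hg : HasFactorialMoments E c g)
    (P : Polynomial (MvPolynomial (Fin 2) ℚ)) :
    HasFactorialMoments E c fun m => P.eval (m : MvPolynomial (Fin 2) ℚ) * g m := by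
  intro h
  induction P using Polynomial.induction_on' with
  | add P P' hP hP' =>
    obtain ⟨Q, hQ⟩ := hP
    obtain ⟨Q', hQ'⟩ := hP'
    refine ⟨Q + Q', fun m => ?_⟩
    simp only [Polynomial.eval_add, add_mul, mul_add, map_add]
    rw [hQ, hQ']
  | monomial n a =>
    obtain ⟨Q, hQ⟩ := hg (h * a)
    refine ⟨Polynomial.X ^ n * Q, fun m => ?_⟩
    have e : h * ((Polynomial.monomial n a).eval (m : MvPolynomial (Fin 2) ℚ) * g m) =
        (m ^ n : ℚ) • (h * a * g m) := by
      rw [Polynomial.eval_monomial, MvPolynomial.smul_eq_C_mul]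
      simp only [map_pow, map_natCast]
      ring
    rw [e, map_smul, hQ, smul_eq_mul, Polynomial.eval_mul, Polynomial.eval_pow, Polynomial.eval_X]
    ring

theorem HasFactorialMoments.sum {ι : Type*} {E : MvPolynomial (Fin 2) ℚ →ₗ[ℚ] ℚ} {c : ℚ}
    {g : ι → ℕ → MvPolynomial (Fin 2) ℚ} (A : Finset ι)
    (hg : ∀ i, HasFactorialMoments E c (g i)) :
    HasFactorialMoments E c fun m => ∑ i ∈ A, g i m := by
  intro h
  choose Q hQ using fun i => hg i h
  refine ⟨∑ i ∈ A, Q i, fun m => ?_⟩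
  simp only [Finset.mul_sum, map_sum, hQ, Polynomial.eval_finsetSum]

theorem hasFactorialMoments_cusp_pow {p q c : ℚ} (hc : 0 < c)
    (hsupp : ∀ i j : ℕ, momentX i * momentY p q j ≠ 0 →
      ∃ N : ℕ, (5 / 6 + i / 2 + j / 3 : ℚ) = c + N) :
    HasFactorialMoments (cuspIntegral p q) c fun m => cusp ^ (m + 1) := by
  intro h
  induction h using MvPolynomial.induction_on' with
  | add g h hg hh =>
    obtain ⟨Q, hQ⟩ := hg
    obtain ⟨Q', hQ'⟩ := hh
    refine ⟨Q + Q', fun m => ?_⟩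
    rw [add_mul, map_add, hQ, hQ', Polynomial.eval_add, mul_add]
  | monomial d a =>
    simp only [cuspIntegral_monomial_mul_pow]
    by_cases h0 : momentX (d 0) * momentY p q (d 1) = 0
    · exact ⟨0, fun m => by simp [h0]⟩
    obtain ⟨N, hN⟩ := hsupp _ _ h0
    have hpos : (∏ k ∈ Finset.range N, (c + k)) ≠ 0 :=
      (Finset.prod_pos fun k _ => by positivity).ne'
    refine ⟨Polynomial.C ((∏ k ∈ Finset.range N, (c + k))⁻¹ *
      (a * (momentX (d 0) * momentY p q (d 1)))) *
        ∏ k ∈ Finset.range N, (Polynomial.X + Polynomial.C (c + 1 + k)), fun m => ?_⟩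
    have h1 := Finset.prod_range_add (fun k : ℕ => c + k) N (m + 1)
    have h2 := Finset.prod_range_add (fun k : ℕ => c + k) (m + 1) N
    rw [add_comm N, h2] at h1
    rw [hN, Polynomial.eval_mul, Polynomial.eval_C, Polynomial.eval_prod]
    have e1 : ∀ k : ℕ, c + N + k = c + ((N + k : ℕ) : ℚ) := fun k => by push_cast; ring
    have e2 : ∀ k : ℕ, (Polynomial.X + Polynomial.C (c + 1 + k)).eval (m : ℚ) =
      c + ((m + 1 + k : ℕ) : ℚ) := fun k => by simp; ring
    simp only [e1, e2]
    field_simp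
    linear_combination (-(a * (momentX (d 0) * momentY p q (d 1)))) * h1

theorem eq_of_forall_natCast_eval {R : Type*} [CommRing R] [IsDomain R] [CharZero R]
    {P Q : Polynomial R} (h : ∀ m : ℕ, P.eval (m : R) = Q.eval (m : R)) : P = Q := by
  refine Polynomial.eq_of_infinite_eval_eq P Q
    ((Set.infinite_range_of_injective (Nat.cast_injective (R := R))).mono ?_)
  rintro _ ⟨m, rfl⟩
  exact h m

theorem SatisfiesBS.dvd_of_moments {b : Polynomial ℚ} (hb : SatisfiesBS cusp 1 b)
    {p q c : ℚ} (hc : 0 < c)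
    (hsupp : ∀ i j : ℕ, momentX i * momentY p q j ≠ 0 →
      ∃ N : ℕ, (5 / 6 + i / 2 + j / 3 : ℚ) = c + N)
    (n : ℕ) (hn : momentY p q n = 1) (hcn : c = 5 / 6 + n / 3) :
    Polynomial.X + Polynomial.C c ∣ b := by
  obtain ⟨A, P, hA⟩ := hb
  simp only [one_mul, mul_one] at hA
  have hG := HasFactorialMoments.sum A fun α => HasFactorialMoments.eval_mul
    (pdIter_induction (fun _ i hg => hg.pderiv i) α (hasFactorialMoments_cusp_pow hc hsupp)) (P α)
  obtain ⟨Q, hQ⟩ := hG (MvPolynomial.monomial (Finsupp.single 1 n) 1)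
  refine ⟨Q, eq_of_forall_natCast_eval fun m => ?_⟩
  have h := hQ m
  beta_reduce at h
  have e : MvPolynomial.monomial (Finsupp.single 1 n) 1 *
      (MvPolynomial.C (b.eval (m : ℚ)) * cusp ^ m) =
      b.eval (m : ℚ) • (MvPolynomial.monomial (Finsupp.single 1 n) 1 * cusp ^ m) := by
    rw [MvPolynomial.smul_eq_C_mul]
    ring
  rw [← hA, e, map_smul, cuspIntegral_monomial_mul_pow, Finset.prod_range_succ] at h
  simp [hn, momentX, ← hcn] at h
  have hpos : (∏ k ∈ Finset.range m, (c + k)) ≠ 0 :=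
    (Finset.prod_pos fun k _ => by positivity).ne'
  apply mul_left_cancel₀ hpos
  simp only [Polynomial.eval_mul, Polynomial.eval_add, Polynomial.eval_X, Polynomial.eval_C]
  linear_combination h

theorem exists_eval_eq_derivation {R A : Type*} [CommRing R] [CommRing A] [Algebra R A]
    (D : Derivation R A A) (Q : Polynomial A) :
    ∃ Q' : Polynomial A, ∀ z : ℤ, Q'.eval (z : A) = D (Q.eval (z : A)) := by
  induction Q using Polynomial.induction_on' with
  | add P Q hP hQ =>
    obtain ⟨P', hP'⟩ := hP
    obtain ⟨Q', hQ'⟩ := hQ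
    exact ⟨P' + Q', fun z => by simp [hP', hQ']⟩
  | monomial n a =>
    refine ⟨Polynomial.monomial n (D a), fun z => ?_⟩
    have hz : D ((z : A) ^ n) = 0 := by rw [← Int.cast_pow, D.map_intCast]
    rw [Polynomial.eval_monomial, Polynomial.eval_monomial, D.leibniz, hz]
    simp [mul_comm]

/-- The sequence `g m` extends to an element of the free module `A[f⁻¹, s] fˢ⁺¹` whose
specialisation at `s = -1` has no pole along `f`. -/
def IsRegularAtNegOne {A : Type*} [CommRing A] (f : A) (g : ℕ → A) : Prop :=
  ∃ (k : ℕ) (Q : Polynomial A) (r : A),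
    (∀ m : ℕ, f ^ k * g m = Q.eval ((m : ℤ) : A) * f ^ (m + 1)) ∧
      Q.eval ((-1 : ℤ) : A) = f ^ k * r

theorem IsRegularAtNegOne.derivation {R A : Type*} [CommRing R] [CommRing A] [Algebra R A]
    (D : Derivation R A A) {f : A} {g : ℕ → A} (hg : IsRegularAtNegOne f g) :
    IsRegularAtNegOne f fun m => D (g m) := by
  obtain ⟨k, Q, r, hQ, hr⟩ := hg
  obtain ⟨Q', hQ'⟩ := exists_eval_eq_derivation D Q
  have hpow : ∀ n : ℕ, f * D (f ^ n) = n * D f * f ^ n := fun n => by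
    induction n with
    | zero => simp
    | succ n ih =>
      rw [pow_succ, D.leibniz]
      simp only [smul_eq_mul, mul_add]
      push_cast
      linear_combination f * ih
  refine ⟨k + 1, Polynomial.C f * Q' + (Polynomial.X + 1) * Polynomial.C (D f) * Q -
    Polynomial.C (k * D f) * Q, D r, fun m => ?_, ?_⟩
  · have h := congrArg (f * D ·) (hQ m)
    simp only [D.leibniz, smul_eq_mul] at h
    have hm := hpow (m + 1)
    push_cast at hm
    simp only [Polynomial.eval_sub, Polynomial.eval_add, Polynomial.eval_mul, Polynomial.eval_C,
      Polynomial.eval_X, Polynomial.eval_one, hQ']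
    push_cast at h ⊢
    have hQm := hQ m
    push_cast at hQm
    linear_combination h - g m * hpow k + Q.eval (m : A) * hm - k * D f * hQm
  · have h := congrArg (f * D ·) hr
    simp only [D.leibniz, smul_eq_mul] at h
    simp only [Polynomial.eval_sub, Polynomial.eval_add, Polynomial.eval_mul, Polynomial.eval_C,
      Polynomial.eval_X, Polynomial.eval_one, hQ']
    push_cast at h hr ⊢
    linear_combination h + r * hpow k - k * D f * hr

theorem IsRegularAtNegOne.eval_mul {A : Type*} [CommRing A] {f : A} {g : ℕ → A}
    (hg : IsRegularAtNegOne f g) (P : Polynomial A) :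
    IsRegularAtNegOne f fun m => P.eval (m : A) * g m := by
  obtain ⟨k, Q, r, hQ, hr⟩ := hg
  refine ⟨k, P * Q, P.eval ((-1 : ℤ) : A) * r, fun m => ?_, ?_⟩
  · have := hQ m
    push_cast at this
    rw [Polynomial.eval_mul]
    push_cast
    linear_combination P.eval (m : A) * this
  · rw [Polynomial.eval_mul, hr]
    ring

theorem IsRegularAtNegOne.sum {ι A : Type*} [CommRing A] {f : A} {g : ι → ℕ → A}
    (S : Finset ι) (hg : ∀ i, IsRegularAtNegOne f (g i)) :
    IsRegularAtNegOne f fun m => ∑ i ∈ S, g i m := by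
  classical
  induction S using Finset.induction_on with
  | empty => exact ⟨0, 0, 0, by simp, by simp⟩
  | insert i S hi ih =>
    simp only [Finset.sum_insert hi]
    obtain ⟨k, Q, r, hQ, hr⟩ := hg i
    obtain ⟨k', Q', r', hQ', hr'⟩ := ih
    refine ⟨k + k', Polynomial.C (f ^ k') * Q + Polynomial.C (f ^ k) * Q', r + r',
      fun m => ?_, ?_⟩
    · rw [Polynomial.eval_add, Polynomial.eval_C_mul, Polynomial.eval_C_mul, pow_add]
      linear_combination f ^ k' * hQ m + f ^ k * hQ' m
    · rw [Polynomial.eval_add, Polynomial.eval_C_mul, Polynomial.eval_C_mul, hr, hr']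
      ring

theorem SatisfiesBS.eval_neg_one {b : Polynomial ℚ} (hb : SatisfiesBS cusp 1 b) :
    b.eval (-1) = 0 := by
  obtain ⟨A, P, hA⟩ := hb
  simp only [one_mul, mul_one] at hA
  have hf : IsRegularAtNegOne cusp fun m => cusp ^ (m + 1) := ⟨0, 1, 1, by simp, by simp⟩
  obtain ⟨k, Q, r, hQ, hr⟩ := IsRegularAtNegOne.sum A fun α => IsRegularAtNegOne.eval_mul
    (pdIter_induction (fun _ i hg => hg.derivation (MvPolynomial.pderiv i)) α hf) (P α)
  have hcusp : cusp ≠ 0 := fun h => by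
    have := congrArg (MvPolynomial.eval ![1, 0]) h
    simp at this
  have hev : ∀ z : ℤ, (b.map MvPolynomial.C).eval (z : MvPolynomial (Fin 2) ℚ) =
      MvPolynomial.C (b.eval (z : ℚ)) := fun z => by
    rw [← map_intCast (MvPolynomial.C (σ := Fin 2) (R := ℚ)) z, Polynomial.eval_map_apply]
  have key : Polynomial.C (cusp ^ k) * b.map MvPolynomial.C = Polynomial.C cusp * Q := by
    refine eq_of_forall_natCast_eval fun m => ?_
    have h := hQ m
    beta_reduce at h
    rw [← hA] at h
    have hm := hev m
    push_cast at h hm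
    rw [Polynomial.eval_C_mul, Polynomial.eval_C_mul, hm]
    apply mul_right_cancel₀ (pow_ne_zero m hcusp)
    linear_combination h
  have h := congrArg (Polynomial.eval (((-1 : ℤ) : MvPolynomial (Fin 2) ℚ))) key
  rw [Polynomial.eval_C_mul, Polynomial.eval_C_mul, hev, hr] at h
  have h' : MvPolynomial.C (b.eval ((-1 : ℤ) : ℚ)) = cusp * r :=
    mul_left_cancel₀ (pow_ne_zero k hcusp) (by linear_combination h)
  have h0 := congrArg (MvPolynomial.eval ![0, 0]) h'
  simpa using h0

theorem pderiv_comm (i j : Fin 2) (g : MvPolynomial (Fin 2) ℚ) :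
    MvPolynomial.pderiv i (MvPolynomial.pderiv j g) =
      MvPolynomial.pderiv j (MvPolynomial.pderiv i g) := by
  have h : ⁅MvPolynomial.pderiv (R := ℚ) i, MvPolynomial.pderiv (R := ℚ) j⁆ = 0 := by
    refine MvPolynomial.derivation_ext fun k => ?_
    simp [Derivation.commutator_apply, MvPolynomial.pderiv_X, Pi.single_apply]
    split_ifs <;> simp
  have := congrArg (· g) h
  simpa [Derivation.commutator_apply, sub_eq_zero] using this

theorem pdIter_fin_two (α : Fin 2 → ℕ) (g : MvPolynomial (Fin 2) ℚ) :
    pdIter α g =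
      (⇑(MvPolynomial.pderiv 1))^[α 1] ((⇑(MvPolynomial.pderiv 0))^[α 0] g) := by
  have hp : (Finset.univ : Finset (Fin 2)).toList.Perm [0, 1] := by
    rw [← Multiset.coe_eq_coe, Finset.coe_toList]
    rfl
  have hc : ∀ i j : Fin 2, Function.Commute (⇑(MvPolynomial.pderiv (R := ℚ) i))
      (⇑(MvPolynomial.pderiv j)) := pderiv_comm
  rw [pdIter, hp.foldl_eq' fun i _ j _ q => ((hc j i).iterate_iterate (α j) (α i)) q]
  rfl

theorem cusp_functional_equation (m : ℕ) :
    MvPolynomial.C ((m + 5 / 6) * (m + 1) * (m + 7 / 6) : ℚ) * cusp ^ m =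
      MvPolynomial.C (1 / 27) * pdIter ![0, 3] (cusp ^ (m + 1)) +
      MvPolynomial.C (1 / 6) * MvPolynomial.X 1 * pdIter ![2, 1] (cusp ^ (m + 1)) +
      MvPolynomial.C (1 / 8) * MvPolynomial.X 0 * pdIter ![3, 0] (cusp ^ (m + 1)) +
      MvPolynomial.C (3 / 8) * pdIter ![2, 0] (cusp ^ (m + 1)) := by
  have e : MvPolynomial.C ((m + 5 / 6) * (m + 1) * (m + 7 / 6) : ℚ) =
      MvPolynomial.C (1 / 216) *
        (6 * (6 * m + 5) * (m + 1) * (6 * m + 7) : MvPolynomial (Fin 2) ℚ) := by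
    rw [show ((m + 5 / 6) * (m + 1) * (m + 7 / 6) : ℚ) =
      1 / 216 * (6 * (6 * m + 5) * (m + 1) * (6 * m + 7)) by ring]
    simp only [map_add, map_mul, map_ofNat, map_natCast, map_one]
  rw [e, show (1 / 27 : ℚ) = 1 / 216 * 8 by norm_num, show (1 / 6 : ℚ) = 1 / 216 * 36 by norm_num,
    show (1 / 8 : ℚ) = 1 / 216 * 27 by norm_num, show (3 / 8 : ℚ) = 1 / 216 * 81 by norm_num]
  simp only [map_mul, map_ofNat, pdIter_fin_two]
  generalize MvPolynomial.C (1 / 216 : ℚ) = a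
  rcases m with _ | _ | m <;>
  · simp [Function.iterate_succ_apply', Derivation.leibniz_pow, Derivation.leibniz,
      MvPolynomial.pderiv_X, Derivation.map_ofNat]
    ring

theorem satisfiesBS_cusp :
    SatisfiesBS cusp 1 ((Polynomial.X + Polynomial.C (5 / 6 : ℚ)) *
      (Polynomial.X + Polynomial.C (1 : ℚ)) * (Polynomial.X + Polynomial.C (7 / 6 : ℚ))) := by
  refine ⟨{![0, 3], ![2, 1], ![3, 0], ![2, 0]}, fun α =>
    if α = ![0, 3] then Polynomial.C (MvPolynomial.C (1 / 27))
    else if α = ![2, 1] then Polynomial.C (MvPolynomial.C (1 / 6) * MvPolynomial.X 1)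
    else if α = ![3, 0] then Polynomial.C (MvPolynomial.C (1 / 8) * MvPolynomial.X 0)
    else Polynomial.C (MvPolynomial.C (3 / 8)), fun m => ?_⟩
  rw [Finset.sum_insert (by decide), Finset.sum_insert (by decide),
    Finset.sum_insert (by decide), Finset.sum_singleton]
  have h := cusp_functional_equation m
  beta_reduce
  rw [if_pos rfl, if_neg (by decide), if_pos rfl, if_neg (by decide), if_neg (by decide),
    if_pos rfl, if_neg (by decide), if_neg (by decide), if_neg (by decide)]
  simp only [Polynomial.eval_C, Polynomial.eval_mul, Polynomial.eval_add, Polynomial.eval_X,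
    mul_one, one_mul]
  rw [h]
  ring

theorem SatisfiesBS.mul_right {σ : Type*} [Fintype σ] {f g : MvPolynomial σ ℚ}
    {b : Polynomial ℚ} (hb : SatisfiesBS f g b) (q : Polynomial ℚ) : SatisfiesBS f g (b * q) := by
  obtain ⟨A, P, hA⟩ := hb
  refine ⟨A, fun α => q.map MvPolynomial.C * P α, fun m => ?_⟩
  have hq : (q.map MvPolynomial.C).eval (m : MvPolynomial σ ℚ) =
      MvPolynomial.C (q.eval (m : ℚ)) := by
    rw [← map_natCast (MvPolynomial.C (σ := σ) (R := ℚ)) m, Polynomial.eval_map_apply]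
  simp only [Polynomial.eval_mul, hq, map_mul, mul_assoc, ← Finset.mul_sum]
  simp only [← mul_assoc] at hA ⊢
  rw [← hA]
  ring

theorem isCoprime_X_add_C {a b : ℚ} (h : a ≠ b) :
    IsCoprime (Polynomial.X + Polynomial.C a) (Polynomial.X + Polynomial.C b) := by
  have := Polynomial.isCoprime_X_sub_C_of_isUnit_sub (a := -a) (b := -b)
    (isUnit_iff_ne_zero.2 (by contrapose! h; linarith))
  simpa using this

end Cusp

theorem bernsteinSato_stmt_5 :
    ∀ b : Polynomial ℚ,
      SatisfiesBS ((X 0) ^ 2 + (X 1) ^ 3 : MvPolynomial (Fin 2) ℚ)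
          (1) b ↔
        (Polynomial.X + Polynomial.C (5 / 6 : ℚ)) *
            (Polynomial.X + Polynomial.C (1 : ℚ)) *
            (Polynomial.X + Polynomial.C (7 / 6 : ℚ)) ∣ b := by
  intro b
  constructor
  · intro hb
    have h1 : Polynomial.X + Polynomial.C (5 / 6 : ℚ) ∣ b := by
      refine SatisfiesBS.dvd_of_moments hb (p := 1) (q := 0) (by norm_num) (fun i j hij => ?_)
        0 rfl (by norm_num)
      obtain ⟨a, rfl⟩ := exists_of_momentX_ne_zero i (left_ne_zero_of_mul hij)
      obtain ⟨e, rfl⟩ := exists_of_momentY_one_zero_ne_zero j (right_ne_zero_of_mul hij)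
      exact ⟨a + e, by push_cast; ring⟩
    have h2 : Polynomial.X + Polynomial.C (7 / 6 : ℚ) ∣ b := by
      refine SatisfiesBS.dvd_of_moments hb (p := 0) (q := 1) (by norm_num) (fun i j hij => ?_)
        1 rfl (by norm_num)
      obtain ⟨a, rfl⟩ := exists_of_momentX_ne_zero i (left_ne_zero_of_mul hij)
      obtain ⟨e, rfl⟩ := exists_of_momentY_zero_one_ne_zero j (right_ne_zero_of_mul hij)
      exact ⟨a + e, by push_cast; ring⟩
    have h3 : Polynomial.X + Polynomial.C (1 : ℚ) ∣ b := by
      have := Polynomial.dvd_iff_isRoot.2 (SatisfiesBS.eval_neg_one hb)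
      simpa using this
    exact ((isCoprime_X_add_C (by norm_num)).mul_left (isCoprime_X_add_C (by norm_num))).mul_dvd
      ((isCoprime_X_add_C (by norm_num)).mul_dvd h1 h3) h2
  · rintro ⟨q, rfl⟩
    exact satisfiesBS_cusp.mul_right q
end

section
/- Let f = z·x² + w·y³ in ℚ[x,y,z,w]. For every b ∈ ℚ[s], b satisfies the Bernstein–Sato functional equation for the pair (f, 1) if and only if (s + 5/6)(s + 1)(s + 7/6)(s + 4/3)(s + 3/2)(s + 5/3)(s + 2) divides b in ℚ[s]; that is, b_f(s) = (s + 5/6)(s + 1)(s + 7/6)(s + 4/3)(s + 3/2)(s + 5/3)(s + 2). -/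
open MvPolynomial Polynomial

namespace BernsteinSato

/-- Partial derivatives of multivariate polynomials commute. -/
lemma pderiv_commute {σ : Type*} (i j : σ) :
    Function.Commute (MvPolynomial.pderiv i : MvPolynomial σ ℚ → MvPolynomial σ ℚ)
      (MvPolynomial.pderiv j) := by
  classical
  intro p
  ext d
  simp only [MvPolynomial.coeff_pderiv, Finsupp.add_apply]
  rw [add_right_comm]
  rcases eq_or_ne i j with rfl | h
  · rfl
  · simp [h, h.symm]
    ring

lemma pdIter_fin_four (α : Fin 4 → ℕ) (p : MvPolynomial (Fin 4) ℚ) :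
    pdIter α p = (MvPolynomial.pderiv 3)^[α 3] ((MvPolynomial.pderiv 2)^[α 2]
      ((MvPolynomial.pderiv 1)^[α 1] ((MvPolynomial.pderiv 0)^[α 0] p))) := by
  have hperm : (Finset.univ : Finset (Fin 4)).toList.Perm [0, 1, 2, 3] := by
    refine (List.perm_ext_iff_of_nodup (Finset.nodup_toList _) (by decide)).2 fun a => ?_
    fin_cases a <;> simp
  have : RightCommutative (fun (q : MvPolynomial (Fin 4) ℚ) (i : Fin 4) =>
      (MvPolynomial.pderiv i)^[α i] q) :=
    ⟨fun q i j => ((pderiv_commute j i).iterate_iterate (α j) (α i)) q⟩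
  rw [pdIter, hperm.foldl_eq]
  rfl

lemma pderiv_pdIter (i : Fin 4) (α : Fin 4 → ℕ) (p : MvPolynomial (Fin 4) ℚ) :
    MvPolynomial.pderiv i (pdIter α p) = pdIter (α + Pi.single i 1) p := by
  have h (k l : Fin 4) (n : ℕ) (q : MvPolynomial (Fin 4) ℚ) :
      MvPolynomial.pderiv k ((MvPolynomial.pderiv l)^[n] q) =
        (MvPolynomial.pderiv l)^[n] (MvPolynomial.pderiv k q) :=
    ((pderiv_commute k l).iterate_right n) q
  simp only [pdIter_fin_four]
  fin_cases i <;> simp [Function.iterate_succ_apply, h]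

lemma coeff_iterate_pderiv {σ : Type*} (i : σ) (n : ℕ) (p : MvPolynomial σ ℚ) (d : σ →₀ ℕ) :
    MvPolynomial.coeff d ((MvPolynomial.pderiv i)^[n] p) =
      MvPolynomial.coeff (d + Finsupp.single i n) p * (d i + n).descFactorial n := by
  classical
  induction n generalizing d with
  | zero => simp
  | succ n ih =>
    rw [Function.iterate_succ_apply', MvPolynomial.coeff_pderiv, ih, add_assoc,
      ← Finsupp.single_add, add_comm 1 n, mul_assoc]
    congr 1
    have := Nat.succ_descFactorial (d i + 1 + n) n
    have h2 := Nat.descFactorial_succ (d i + (n + 1)) n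
    simp only [Finsupp.add_apply, Finsupp.single_eq_same]
    rw [show d i + (n + 1) - n = d i + 1 by omega] at h2
    rw [h2, show d i + (n + 1) = d i + 1 + n by omega]
    push_cast
    ring

lemma coeff_pdIter (α : Fin 4 → ℕ) (p : MvPolynomial (Fin 4) ℚ) (d : Fin 4 →₀ ℕ) :
    MvPolynomial.coeff d (pdIter α p) =
      MvPolynomial.coeff (d + Finsupp.equivFunOnFinite.symm α) p *
        ((d 0 + α 0).descFactorial (α 0) * (d 1 + α 1).descFactorial (α 1) *
          (d 2 + α 2).descFactorial (α 2) * (d 3 + α 3).descFactorial (α 3)) := by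
  have h : d + Finsupp.equivFunOnFinite.symm α = d + Finsupp.single 3 (α 3) +
      Finsupp.single 2 (α 2) + Finsupp.single 1 (α 1) + Finsupp.single 0 (α 0) := by
    ext i
    fin_cases i <;> simp
  rw [pdIter_fin_four, h]
  simp only [coeff_iterate_pderiv]
  simp
  ring

/-- The families `m ↦ P(m) • f ^ (m + 1)`, where `P` is a differential operator depending
polynomially on a parameter. -/
def IsOperatorFamily (f : MvPolynomial (Fin 4) ℚ) (G : ℕ → MvPolynomial (Fin 4) ℚ) : Prop :=
  ∃ p : (Fin 4 → ℕ) →₀ Polynomial (MvPolynomial (Fin 4) ℚ), ∀ m : ℕ,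
    G m = p.sum fun α q => Polynomial.eval (m : MvPolynomial (Fin 4) ℚ) q * pdIter α (f ^ (m + 1))

namespace IsOperatorFamily

variable {f : MvPolynomial (Fin 4) ℚ} {G H : ℕ → MvPolynomial (Fin 4) ℚ}

lemma single (f : MvPolynomial (Fin 4) ℚ) (α : Fin 4 → ℕ)
    (q : Polynomial (MvPolynomial (Fin 4) ℚ)) :
    IsOperatorFamily f fun m =>
      Polynomial.eval (m : MvPolynomial (Fin 4) ℚ) q * pdIter α (f ^ (m + 1)) :=
  ⟨Finsupp.single α q, fun m => by simp⟩

lemma pow_succ (f : MvPolynomial (Fin 4) ℚ) : IsOperatorFamily f fun m => f ^ (m + 1) := by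
  simpa [pdIter_fin_four] using single f 0 1

lemma add (hG : IsOperatorFamily f G) (hH : IsOperatorFamily f H) :
    IsOperatorFamily f (G + H) := by
  obtain ⟨p, hp⟩ := hG
  obtain ⟨q, hq⟩ := hH
  refine ⟨p + q, fun m => ?_⟩
  rw [Pi.add_apply, hp, hq, Finsupp.sum_add_index']
  · simp
  · intro α a b
    simp [add_mul]

lemma sum {ι : Type*} (s : Finset ι) (F : ι → ℕ → MvPolynomial (Fin 4) ℚ)
    (hF : ∀ i ∈ s, IsOperatorFamily f (F i)) : IsOperatorFamily f (∑ i ∈ s, F i) :=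
  Finset.sum_induction _ _ (fun _ _ => add) ⟨0, fun m => by simp⟩ hF

lemma eval_mul (hG : IsOperatorFamily f G) (c : Polynomial (MvPolynomial (Fin 4) ℚ)) :
    IsOperatorFamily f fun m => Polynomial.eval (m : MvPolynomial (Fin 4) ℚ) c * G m := by
  obtain ⟨p, hp⟩ := hG
  refine ⟨c • p, fun m => ?_⟩
  simp only [hp, Finsupp.mul_sum]
  rw [Finsupp.sum_smul_index (by simp)]
  simp [mul_assoc]

lemma const_mul (hG : IsOperatorFamily f G) (c : MvPolynomial (Fin 4) ℚ) :
    IsOperatorFamily f fun m => c * G m := by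
  simpa using hG.eval_mul (Polynomial.C c)

lemma exists_eval_eq_pderiv (i : Fin 4) (q : Polynomial (MvPolynomial (Fin 4) ℚ)) :
    ∃ q' : Polynomial (MvPolynomial (Fin 4) ℚ), ∀ m : ℕ,
      Polynomial.eval (m : MvPolynomial (Fin 4) ℚ) q' =
        MvPolynomial.pderiv i (Polynomial.eval (m : MvPolynomial (Fin 4) ℚ) q) := by
  induction q using Polynomial.induction_on' with
  | add p q hp hq =>
    obtain ⟨p', hp⟩ := hp
    obtain ⟨q', hq⟩ := hq
    exact ⟨p' + q', fun m => by simp [hp, hq]⟩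
  | monomial n a =>
    refine ⟨Polynomial.monomial n (MvPolynomial.pderiv i a), fun m => ?_⟩
    simp [mul_comm]

lemma pderiv (hG : IsOperatorFamily f G) (i : Fin 4) :
    IsOperatorFamily f fun m => MvPolynomial.pderiv i (G m) := by
  obtain ⟨p, hp⟩ := hG
  choose D hD using exists_eval_eq_pderiv i
  have h := sum p.support _ fun α _ =>
    (single f α (D (p α))).add (single f (α + Pi.single i 1) (p α))
  refine (congrArg (IsOperatorFamily f) (funext fun m => ?_)).mp h
  simp only [hp, Finsupp.sum, map_sum, MvPolynomial.pderiv_mul, hD, pderiv_pdIter,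
    Finset.sum_apply, Pi.add_apply]

end IsOperatorFamily

lemma satisfiesBS_one_iff (f : MvPolynomial (Fin 4) ℚ) (b : Polynomial ℚ) :
    SatisfiesBS f 1 b ↔
      IsOperatorFamily f fun m => MvPolynomial.C (Polynomial.eval (m : ℚ) b) * f ^ m := by
  constructor
  · rintro ⟨A, p, h⟩
    convert IsOperatorFamily.sum A _ fun α _ => IsOperatorFamily.single f α (p α) using 1
    funext m
    simpa using h m
  · rintro ⟨p, h⟩
    exact ⟨p.support, p, fun m => by simpa [Finsupp.sum] using h m⟩

/-- The exponent of `(z x²)^i (w y³)^j`. -/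
noncomputable def expo (i j : ℕ) : Fin 4 →₀ ℕ :=
  Finsupp.equivFunOnFinite.symm ![2 * i, 3 * j, i, j]

@[simp] lemma expo_apply_zero (i j : ℕ) : expo i j 0 = 2 * i := rfl
@[simp] lemma expo_apply_one (i j : ℕ) : expo i j 1 = 3 * j := rfl
@[simp] lemma expo_apply_two (i j : ℕ) : expo i j 2 = i := rfl
@[simp] lemma expo_apply_three (i j : ℕ) : expo i j 3 = j := rfl

/-- The polynomial `z x² + w y³`. -/
noncomputable abbrev cusp : MvPolynomial (Fin 4) ℚ :=
  MvPolynomial.X 2 * MvPolynomial.X 0 ^ 2 + MvPolynomial.X 3 * MvPolynomial.X 1 ^ 3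

/-- The binary form `∑ aᵢ (z x²)^i (w y³)^(N - i)`. -/
noncomputable def form (N : ℕ) (a : ℕ → ℚ) : MvPolynomial (Fin 4) ℚ :=
  ∑ i ∈ Finset.range (N + 1), MvPolynomial.monomial (expo i (N - i)) (a i)

lemma form_add (N : ℕ) (a b : ℕ → ℚ) : form N (a + b) = form N a + form N b := by
  simp [form, Finset.sum_add_distrib]

lemma C_mul_form (N : ℕ) (c : ℚ) (a : ℕ → ℚ) :
    MvPolynomial.C c * form N a = form N fun i => c * a i := by
  simp [form, Finset.mul_sum, MvPolynomial.C_mul_monomial]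

lemma form_congr {N : ℕ} {a b : ℕ → ℚ} (h : ∀ i ≤ N, a i = b i) : form N a = form N b :=
  Finset.sum_congr rfl fun i hi => by rw [h i (by simpa [Nat.lt_succ_iff] using hi)]

lemma X_pow_mul_X_pow (i j : ℕ) :
    ((MvPolynomial.X 2 * MvPolynomial.X 0 ^ 2) ^ i * (MvPolynomial.X 3 * MvPolynomial.X 1 ^ 3) ^ j :
      MvPolynomial (Fin 4) ℚ) = MvPolynomial.monomial (expo i j) 1 := by
  rw [MvPolynomial.monomial_eq, Finsupp.prod_fintype _ _ (by simp)]
  simp [Fin.prod_univ_four, mul_pow, ← pow_mul]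
  ring

lemma cusp_pow (N : ℕ) : cusp ^ N = form N fun i => N.choose i := by
  rw [cusp, add_pow, form]
  refine Finset.sum_congr rfl fun i _ => ?_
  rw [X_pow_mul_X_pow, mul_comm, ← map_natCast (MvPolynomial.C (σ := Fin 4) (R := ℚ)),
    MvPolynomial.C_mul_monomial, mul_one]

lemma X_mul_pderiv_form (N : ℕ) (a : ℕ → ℚ) :
    MvPolynomial.X 2 * MvPolynomial.pderiv 2 (form N a) = form N fun i => i * a i := by
  simp only [form, map_sum, Finset.mul_sum, MvPolynomial.X_mul_pderiv_monomial]
  refine Finset.sum_congr rfl fun i _ => ?_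
  rw [expo_apply_two, MvPolynomial.smul_monomial, nsmul_eq_mul]

lemma pderiv_pderiv_pderiv_form (N : ℕ) (a : ℕ → ℚ) :
    MvPolynomial.pderiv 0 (MvPolynomial.pderiv 0 (MvPolynomial.pderiv 2 (form (N + 1) a))) =
      form N fun i => (i + 1) * (2 * i + 2) * (2 * i + 1) * a (i + 1) := by
  simp only [form, map_sum, MvPolynomial.pderiv_monomial]
  rw [Finset.sum_range_succ']
  simp only [expo_apply_two, Nat.cast_zero, mul_zero, zero_mul, map_zero, add_zero]
  refine Finset.sum_congr rfl fun i hi => ?_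
  congr 1
  · congr 1
    ext k
    fin_cases k
    all_goals
      simp
      try omega
  · simp
    ring

lemma pderiv_pderiv_pderiv_pderiv_form (N : ℕ) (a : ℕ → ℚ) :
    MvPolynomial.pderiv 1 (MvPolynomial.pderiv 1 (MvPolynomial.pderiv 1
      (MvPolynomial.pderiv 3 (form (N + 1) a)))) =
      form N fun i => ((N : ℚ) - i + 1) * (3 * (N - i) + 3) * (3 * (N - i) + 2) *
        (3 * (N - i) + 1) * a i := by
  simp only [form, map_sum, MvPolynomial.pderiv_monomial]
  rw [Finset.sum_range_succ]
  simp only [expo_apply_three, Nat.sub_self, Nat.cast_zero, mul_zero, zero_mul, map_zero, add_zero]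
  refine Finset.sum_congr rfl fun i hi => ?_
  obtain ⟨j, rfl⟩ := Nat.exists_eq_add_of_le (Nat.lt_succ_iff.1 (Finset.mem_range.1 hi))
  have hj : i + j + 1 - i = j + 1 := by omega
  rw [hj]
  congr 1
  · congr 1
    ext k
    fin_cases k
    all_goals
      simp
      try omega
  · simp
    push_cast [show 3 * (j + 1) - 1 = 3 * j + 2 by omega,
      show 3 * (j + 1) - 1 - 1 = 3 * j + 1 by omega]
    ring

lemma isOperatorFamily_form (Q : MvPolynomial (Fin 2) ℚ) :
    IsOperatorFamily cusp fun m => form (m + 1) fun i =>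
      MvPolynomial.eval ![(i : ℚ), (m : ℚ)] Q * (m + 1).choose i := by
  induction Q using MvPolynomial.induction_on with
  | C c =>
    refine (congrArg (IsOperatorFamily cusp) (funext fun m => ?_)).mp
      ((IsOperatorFamily.pow_succ cusp).const_mul (MvPolynomial.C c))
    simp [cusp_pow, C_mul_form]
  | add P Q hP hQ =>
    refine (congrArg (IsOperatorFamily cusp) (funext fun m => ?_)).mp (hP.add hQ)
    rw [Pi.add_apply, ← form_add]
    exact form_congr fun i _ => by simp [add_mul]
  | mul_X P k hP =>
    fin_cases k
    · refine (congrArg (IsOperatorFamily cusp) (funext fun m => ?_)).mp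
        ((hP.pderiv 2).const_mul (MvPolynomial.X 2))
      rw [X_mul_pderiv_form]
      exact form_congr fun i _ => by simp; ring
    · refine (congrArg (IsOperatorFamily cusp) (funext fun m => ?_)).mp
        (hP.eval_mul Polynomial.X)
      rw [Polynomial.eval_X, ← map_natCast (MvPolynomial.C (σ := Fin 4) (R := ℚ)), C_mul_form]
      exact form_congr fun i _ => by simp; ring

/-- The Bernstein–Sato polynomial of `z x² + w y³`. -/
noncomputable def cuspBS : Polynomial ℚ :=
  (Polynomial.X + Polynomial.C (5 / 6 : ℚ)) *
    (Polynomial.X + Polynomial.C (1 : ℚ)) *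
    (Polynomial.X + Polynomial.C (7 / 6 : ℚ)) *
    (Polynomial.X + Polynomial.C (4 / 3 : ℚ)) *
    (Polynomial.X + Polynomial.C (3 / 2 : ℚ)) *
    (Polynomial.X + Polynomial.C (5 / 3 : ℚ)) *
    (Polynomial.X + Polynomial.C (2 : ℚ))

lemma isOperatorFamily_cuspBS : IsOperatorFamily cusp fun m =>
    MvPolynomial.C (Polynomial.eval (m : ℚ) cuspBS) * cusp ^ m := by
  let A (i : MvPolynomial (Fin 2) ℚ) : MvPolynomial (Fin 2) ℚ :=
    (i + 1) * (i + MvPolynomial.C (1 / 2))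
  let c (i j : MvPolynomial (Fin 2) ℚ) (b : ℚ) : MvPolynomial (Fin 2) ℚ :=
    2 * i + MvPolynomial.C (3 / 2) + j + MvPolynomial.C b
  let t (i j : MvPolynomial (Fin 2) ℚ) (b : ℚ) : MvPolynomial (Fin 2) ℚ :=
    (j + MvPolynomial.C b) * c i j b
  let i' : MvPolynomial (Fin 2) ℚ := MvPolynomial.X 0 - 1
  let i : MvPolynomial (Fin 2) ℚ := MvPolynomial.X 0
  let s : MvPolynomial (Fin 2) ℚ := MvPolynomial.X 1
  let t₁ := t i' (s - i') 1
  let t₂ := t i' (s - i') (1 / 3)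
  let t₃ := t i' (s - i') (2 / 3)
  let P := MvPolynomial.C (1 / 4) * (A i' ^ 2 + A i' * (t₁ + t₂ + t₃) + (t₁ * t₂ + t₁ * t₃ + t₂ * t₃))
  let Q := MvPolynomial.C (1 / 27) *
    (c i (s - i) 1 * c i (s - i) (1 / 3) * c i (s - i) (2 / 3))
  have hP := (((isOperatorFamily_form P).pderiv 2).pderiv 0).pderiv 0
  have hQ := ((((isOperatorFamily_form Q).pderiv 3).pderiv 1).pderiv 1).pderiv 1
  refine (congrArg (IsOperatorFamily cusp) (funext fun m => ?_)).mp (hP.add hQ)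
  rw [Pi.add_apply, pderiv_pderiv_pderiv_form, pderiv_pderiv_pderiv_pderiv_form, ← form_add,
    cusp_pow, C_mul_form]
  refine form_congr fun k hk => ?_
  have hk₁ : ((m + 1).choose (k + 1) : ℚ) * (k + 1) = (m + 1) * m.choose k := by
    exact_mod_cast (Nat.add_one_mul_choose_eq m k).symm
  have hk₂ : ((m + 1).choose k : ℚ) * (m - k + 1) = (m + 1) * m.choose k := by
    have := Nat.choose_mul_succ_eq m k
    rw [show m + 1 - k = m - k + 1 by omega] at this
    zify [hk] at this
    rw [mul_comm (m + 1 : ℚ)]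
    exact_mod_cast this.symm
  have hPQ : ((m : ℚ) + 1) *
      ((2 * k + 2) * (2 * k + 1) * MvPolynomial.eval ![((k + 1 : ℕ) : ℚ), (m : ℚ)] P +
        (3 * (m - k) + 3) * (3 * (m - k) + 2) * (3 * (m - k) + 1) *
          MvPolynomial.eval ![(k : ℚ), (m : ℚ)] Q) = Polynomial.eval (m : ℚ) cuspBS := by
    simp only [P, Q, A, c, t, t₁, t₂, t₃, i, i', s, cuspBS, map_mul, map_add, map_sub, map_pow,
      map_one, map_ofNat, MvPolynomial.eval_C, MvPolynomial.eval_X, Polynomial.eval_mul,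
      Polynomial.eval_add, Polynomial.eval_one, Polynomial.eval_ofNat, Polynomial.eval_X, Polynomial.eval_C, Matrix.cons_val_zero,
      Matrix.cons_val_one, Nat.cast_add, Nat.cast_one]
    ring
  rw [Pi.add_apply, ← hPQ]
  linear_combination
    (2 * k + 2) * (2 * k + 1) * MvPolynomial.eval ![((k + 1 : ℕ) : ℚ), (m : ℚ)] P * hk₁ +
      (3 * (m - k) + 3) * (3 * (m - k) + 2) * (3 * (m - k) + 1) *
        MvPolynomial.eval ![(k : ℚ), (m : ℚ)] Q * hk₂

lemma eval_polynomial_aeval {σ : Type*} (x : σ → ℚ) (P : MvPolynomial σ ℚ) (b : Polynomial ℚ) :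
    MvPolynomial.eval x (Polynomial.aeval P b) = b.eval (MvPolynomial.eval x P) := by
  rw [Polynomial.aeval_def, Polynomial.hom_eval₂, Polynomial.eval, MvPolynomial.algebraMap_eq]
  congr 1
  exact Subsingleton.elim _ _

lemma coeff_expo_form (i j : ℕ) (a : ℕ → ℚ) :
    MvPolynomial.coeff (expo i j) (form (i + j) a) = a i := by
  classical
  rw [form, MvPolynomial.coeff_sum, Finset.sum_eq_single_of_mem i (by simp)]
  · simp
  · intro k _ hk
    rw [MvPolynomial.coeff_monomial, if_neg]
    intro h
    exact hk (by simpa using DFunLike.congr_fun h 2)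

lemma exists_expo_of_coeff_form_ne_zero {N : ℕ} {a : ℕ → ℚ} {d : Fin 4 →₀ ℕ}
    (h : MvPolynomial.coeff d (form N a) ≠ 0) : ∃ i j, i + j = N ∧ d = expo i j := by
  classical
  rw [form, MvPolynomial.coeff_sum] at h
  obtain ⟨i, hi, h⟩ := Finset.exists_ne_zero_of_sum_ne_zero h
  rw [MvPolynomial.coeff_monomial] at h
  refine ⟨i, N - i, by simp at hi; omega, ?_⟩
  by_contra h'
  exact h (if_neg (Ne.symm h'))

lemma choose_mul_descFactorial {i j k g a : ℕ} (hg : g ≤ i) (ha : a + k ≤ j) :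
    (i + j + 1).choose (i + k + 1) * (i + k + 1).descFactorial (g + k + 1) *
        (j - k).descFactorial a =
      (i + j).choose i * (i + j + 1) * i.descFactorial g * j.descFactorial (a + k) := by
  have h₀ := Nat.add_choose_mul_factorial_mul_factorial (i + k + 1) (j - k)
  have h₁ := Nat.add_choose_mul_factorial_mul_factorial i j
  have h₂ := Nat.factorial_mul_descFactorial (n := i + k + 1) (k := g + k + 1) (by omega)
  have h₃ := Nat.factorial_mul_descFactorial (n := j - k) (k := a) (by omega)
  have h₄ := Nat.factorial_mul_descFactorial hg
  have h₅ := Nat.factorial_mul_descFactorial ha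
  rw [← Nat.choose_symm_add] at h₁
  rw [← Nat.choose_symm_add, show i + k + 1 + (j - k) = i + j + 1 by omega, Nat.factorial_succ (i + j)] at h₀
  rw [show i + k + 1 - (g + k + 1) = i - g by omega] at h₂
  rw [show j - k - a = j - (a + k) by omega] at h₃
  refine Nat.eq_of_mul_eq_mul_left
    (Nat.mul_pos (i - g).factorial_pos (j - (a + k)).factorial_pos) ?_
  calc _ = (i + j + 1).choose (i + k + 1) *
        ((i - g).factorial * (i + k + 1).descFactorial (g + k + 1)) *
        ((j - (a + k)).factorial * (j - k).descFactorial a) := by ring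
    _ = (i + j + 1) * ((i + j).choose i * ((i - g).factorial * i.descFactorial g) *
        ((j - (a + k)).factorial * j.descFactorial (a + k))) := by
      rw [h₂, h₃, h₀, h₄, h₅, h₁]
    _ = _ := by ring

/-- The set on which the coefficients of all families `P(m) • (z x² + w y³) ^ (m + 1)` vanish, as
polynomials in the exponents of `z` and `w`. -/
def IsRootPair (u v : ℚ) : Prop :=
  u + v = -1 ∨ ((u = -1 ∨ u = -1 / 2) ∧ (v = -1 ∨ v = -1 / 3 ∨ v = -2 / 3))

/-- The normalized coefficients of `(z x²)^i (w y³)^j` in `G (i + j)` are eventually given by a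
polynomial in `i` and `j` vanishing at all root pairs. -/
def HasVanishingCoeff (G : ℕ → MvPolynomial (Fin 4) ℚ) : Prop :=
  ∃ H : MvPolynomial (Fin 2) ℚ, (∀ u v, IsRootPair u v → MvPolynomial.eval ![u, v] H = 0) ∧
    ∃ N, ∀ i j, N ≤ i → N ≤ j → MvPolynomial.coeff (expo i j) (G (i + j)) =
      (i + j).choose i * MvPolynomial.eval ![(i : ℚ), (j : ℚ)] H

namespace HasVanishingCoeff

variable {G G' : ℕ → MvPolynomial (Fin 4) ℚ}

lemma zero : HasVanishingCoeff 0 := ⟨0, by simp, 0, by simp⟩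

lemma add (hG : HasVanishingCoeff G) (hG' : HasVanishingCoeff G') :
    HasVanishingCoeff (G + G') := by
  obtain ⟨H, hH, N, hN⟩ := hG
  obtain ⟨H', hH', N', hN'⟩ := hG'
  refine ⟨H + H', fun u v h => by simp [hH u v h, hH' u v h], max N N', fun i j hi hj => ?_⟩
  rw [Pi.add_apply, MvPolynomial.coeff_add, hN i j (le_of_max_le_left hi) (le_of_max_le_left hj),
    hN' i j (le_of_max_le_right hi) (le_of_max_le_right hj), map_add, mul_add]

lemma sum {ι : Type*} (s : Finset ι) (F : ι → ℕ → MvPolynomial (Fin 4) ℚ)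
    (hF : ∀ i ∈ s, HasVanishingCoeff (F i)) : HasVanishingCoeff (∑ i ∈ s, F i) :=
  Finset.sum_induction _ _ (fun _ _ => add) zero hF

lemma eval_mul (hG : HasVanishingCoeff G) (c : Polynomial ℚ) :
    HasVanishingCoeff fun m => MvPolynomial.C (Polynomial.eval (m : ℚ) c) * G m := by
  obtain ⟨H, hH, N, hN⟩ := hG
  refine ⟨Polynomial.aeval (MvPolynomial.X 0 + MvPolynomial.X 1) c * H,
    fun u v h => by simp [hH u v h], N, fun i j hi hj => ?_⟩
  rw [MvPolynomial.coeff_C_mul, hN i j hi hj, map_mul, eval_polynomial_aeval]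
  simp only [map_add, MvPolynomial.eval_X, Matrix.cons_val_zero, Matrix.cons_val_one]
  push_cast
  ring

end HasVanishingCoeff

/-- The falling factorial of a bivariate polynomial. -/
noncomputable def fall (n : ℕ) (P : MvPolynomial (Fin 2) ℚ) : MvPolynomial (Fin 2) ℚ :=
  Polynomial.aeval P (descPochhammer ℚ n)

lemma eval_fall {n k : ℕ} {P : MvPolynomial (Fin 2) ℚ} {x : Fin 2 → ℚ}
    (h : MvPolynomial.eval x P = k) : MvPolynomial.eval x (fall n P) = k.descFactorial n := by
  rw [fall, eval_polynomial_aeval, h, descPochhammer_eval_eq_descFactorial]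

lemma hasVanishingCoeff_monomial_mul (γ : Fin 4 →₀ ℕ) (α : Fin 4 → ℕ) :
    HasVanishingCoeff fun m => MvPolynomial.monomial γ 1 * pdIter α (cusp ^ (m + 1)) := by
  set N := γ 0 + γ 1 + γ 2 + γ 3 + α 0 + α 1 + α 2 + α 3 with hN
  have hcoeff (i j : ℕ) (hi : N ≤ i) (hj : N ≤ j) :
      MvPolynomial.coeff (expo i j)
        (MvPolynomial.monomial γ 1 * pdIter α (cusp ^ (i + j + 1))) =
      MvPolynomial.coeff (expo i j - γ + Finsupp.equivFunOnFinite.symm α)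
        (form (i + j + 1) fun l => (i + j + 1).choose l) *
        ((2 * i - γ 0 + α 0).descFactorial (α 0) * (3 * j - γ 1 + α 1).descFactorial (α 1) *
          (i - γ 2 + α 2).descFactorial (α 2) * (j - γ 3 + α 3).descFactorial (α 3)) := by
    have hle : γ ≤ expo i j := fun l => by
      fin_cases l <;> simp <;> omega
    rw [MvPolynomial.coeff_monomial_mul', if_pos hle, one_mul, coeff_pdIter, cusp_pow]
    rfl
  by_cases hA : ∃ k, α 0 = γ 0 + 2 * (k + 1) ∧ α 2 = γ 2 + k + 1 ∧ γ 3 = α 3 + k ∧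
      γ 1 = α 1 + 3 * k
  · obtain ⟨k, h0, h2, h3, h1⟩ := hA
    refine ⟨(MvPolynomial.X 0 + MvPolynomial.X 1 + 1) *
      fall (α 0) (2 * MvPolynomial.X 0 + 2 * ((k : MvPolynomial (Fin 2) ℚ) + 1)) * fall (γ 2) (MvPolynomial.X 0) *
      fall (γ 3) (MvPolynomial.X 1) * fall (α 1) (3 * MvPolynomial.X 1 - 3 * (k : MvPolynomial (Fin 2) ℚ)), ?_, N, ?_⟩
    · rintro u v (h | ⟨rfl | rfl, -⟩)
      · simp [h]
      · rw [map_mul, map_mul, map_mul, map_mul, eval_fall (k := 2 * k) (by simp; ring),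
          Nat.descFactorial_of_lt (by omega)]
        simp
      · rw [map_mul, map_mul, map_mul, map_mul, eval_fall (k := 2 * k + 1) (by simp; ring),
          Nat.descFactorial_of_lt (by omega)]
        simp
    · intro i j hi hj
      have he : expo i j - γ + Finsupp.equivFunOnFinite.symm α = expo (i + k + 1) (j - k) := by
        ext l
        fin_cases l <;> simp <;> omega
      rw [hcoeff i j hi hj, he, show i + j + 1 = i + k + 1 + (j - k) by omega, coeff_expo_form,
        show i + k + 1 + (j - k) = i + j + 1 by omega,
        show 2 * i - γ 0 + α 0 = 2 * i + 2 * (k + 1) by omega,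
        show 3 * j - γ 1 + α 1 = 3 * (j - k) by omega,
        show i - γ 2 + α 2 = i + k + 1 by omega, show j - γ 3 + α 3 = j - k by omega]
      simp only [map_mul]
      rw [eval_fall (n := α 0) (k := 2 * i + 2 * (k + 1)) (by simp),
        eval_fall (n := α 1) (k := 3 * (j - k)) (by
          simp [Nat.cast_sub (show k ≤ j by omega)]; ring),
        eval_fall (n := γ 2) (k := i) (by simp), eval_fall (n := γ 3) (k := j) (by simp)]
      have := choose_mul_descFactorial (i := i) (j := j) (k := k) (g := γ 2) (a := α 3)
        (by omega) (by omega)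
      rw [← h2, ← h3] at this
      have : _ = _ := congrArg (Nat.cast : ℕ → ℚ) this
      push_cast at this
      simp only [map_add, map_one, MvPolynomial.eval_X, Matrix.cons_val_zero, Matrix.cons_val_one]
      linear_combination ((2 * i + 2 * (k + 1)).descFactorial (α 0) : ℚ) *
        (3 * (j - k)).descFactorial (α 1) * this
  by_cases hB : ∃ k, α 1 = γ 1 + 3 * (k + 1) ∧ α 3 = γ 3 + k + 1 ∧ γ 2 = α 2 + k ∧
      γ 0 = α 0 + 2 * k
  · obtain ⟨k, h1, h3, h2, h0⟩ := hB
    refine ⟨(MvPolynomial.X 0 + MvPolynomial.X 1 + 1) *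
      fall (α 1) (3 * MvPolynomial.X 1 + 3 * ((k : MvPolynomial (Fin 2) ℚ) + 1)) * fall (γ 2) (MvPolynomial.X 0) *
      fall (γ 3) (MvPolynomial.X 1) * fall (α 0) (2 * MvPolynomial.X 0 - 2 * (k : MvPolynomial (Fin 2) ℚ)), ?_, N, ?_⟩
    · rintro u v (h | ⟨-, rfl | rfl | rfl⟩)
      · simp [h]
      · rw [map_mul, map_mul, map_mul, map_mul, eval_fall (k := 3 * k) (by simp; ring),
          Nat.descFactorial_of_lt (by omega)]
        simp
      · rw [map_mul, map_mul, map_mul, map_mul, eval_fall (k := 3 * k + 2) (by simp; ring),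
          Nat.descFactorial_of_lt (by omega)]
        simp
      · rw [map_mul, map_mul, map_mul, map_mul, eval_fall (k := 3 * k + 1) (by simp; ring),
          Nat.descFactorial_of_lt (by omega)]
        simp
    · intro i j hi hj
      have he : expo i j - γ + Finsupp.equivFunOnFinite.symm α = expo (i - k) (j + k + 1) := by
        ext l
        fin_cases l <;> simp <;> omega
      rw [hcoeff i j hi hj, he, show i + j + 1 = i - k + (j + k + 1) by omega, coeff_expo_form,
        show i - k + (j + k + 1) = i + j + 1 by omega,
        show 2 * i - γ 0 + α 0 = 2 * (i - k) by omega,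
        show 3 * j - γ 1 + α 1 = 3 * j + 3 * (k + 1) by omega,
        show i - γ 2 + α 2 = i - k by omega, show j - γ 3 + α 3 = j + k + 1 by omega]
      simp only [map_mul]
      rw [eval_fall (n := α 1) (k := 3 * j + 3 * (k + 1)) (by simp),
        eval_fall (n := α 0) (k := 2 * (i - k)) (by
          simp [Nat.cast_sub (show k ≤ i by omega)]; ring),
        eval_fall (n := γ 2) (k := i) (by simp), eval_fall (n := γ 3) (k := j) (by simp)]
      have := choose_mul_descFactorial (i := j) (j := i) (k := k) (g := γ 3) (a := α 2)
        (by omega) (by omega)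
      rw [← h2, ← h3, add_comm j i, ← Nat.choose_symm_add,
        Nat.choose_symm_of_eq_add (show i + j + 1 = j + k + 1 + (i - k) by omega)] at this
      have : _ = _ := congrArg (Nat.cast : ℕ → ℚ) this
      push_cast at this
      simp only [map_add, map_one, MvPolynomial.eval_X, Matrix.cons_val_zero, Matrix.cons_val_one]
      linear_combination ((3 * j + 3 * (k + 1)).descFactorial (α 1) : ℚ) *
        (2 * (i - k)).descFactorial (α 0) * this
  · refine ⟨0, by simp, N, fun i j hi hj => ?_⟩
    rw [hcoeff i j hi hj, map_zero (MvPolynomial.eval _), mul_zero]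
    by_contra h
    obtain ⟨i', j', hij, he⟩ := exists_expo_of_coeff_form_ne_zero (left_ne_zero_of_mul h)
    have e0 : 2 * i - γ 0 + α 0 = 2 * i' := DFunLike.congr_fun he 0
    have e1 : 3 * j - γ 1 + α 1 = 3 * j' := DFunLike.congr_fun he 1
    have e2 : i - γ 2 + α 2 = i' := DFunLike.congr_fun he 2
    have e3 : j - γ 3 + α 3 = j' := DFunLike.congr_fun he 3
    rcases lt_or_ge i i' with hlt | hle
    · exact hA ⟨i' - i - 1, by omega, by omega, by omega, by omega⟩
    · exact hB ⟨i - i', by omega, by omega, by omega, by omega⟩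

lemma hasVanishingCoeff_eval_mul (q : Polynomial (MvPolynomial (Fin 4) ℚ)) (α : Fin 4 → ℕ) :
    HasVanishingCoeff fun m =>
      Polynomial.eval (m : MvPolynomial (Fin 4) ℚ) q * pdIter α (cusp ^ (m + 1)) := by
  induction q using Polynomial.induction_on' with
  | add p q hp hq =>
    refine (congrArg HasVanishingCoeff (funext fun m => ?_)).mp (hp.add hq)
    rw [Pi.add_apply, Polynomial.eval_add, add_mul]
  | monomial n a =>
    induction a using MvPolynomial.induction_on' with
    | monomial γ c =>
      refine (congrArg HasVanishingCoeff (funext fun m => ?_)).mp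
        ((hasVanishingCoeff_monomial_mul γ α).eval_mul (Polynomial.monomial n c))
      rw [Polynomial.eval_monomial, Polynomial.eval_monomial, map_mul, map_pow, map_natCast,
        ← mul_one c, ← MvPolynomial.C_mul_monomial, mul_one]
      ring
    | add a b ha hb =>
      refine (congrArg HasVanishingCoeff (funext fun m => ?_)).mp (ha.add hb)
      rw [Pi.add_apply, map_add, Polynomial.eval_add, add_mul]

lemma IsOperatorFamily.hasVanishingCoeff {G : ℕ → MvPolynomial (Fin 4) ℚ}
    (hG : IsOperatorFamily cusp G) : HasVanishingCoeff G := by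
  obtain ⟨p, hp⟩ := hG
  refine (congrArg HasVanishingCoeff (funext fun m => ?_)).mp
    (HasVanishingCoeff.sum p.support _ fun α _ => hasVanishingCoeff_eval_mul (p α) α)
  rw [hp, Finsupp.sum, Finset.sum_apply]

lemma isRoot_of_isRootPair {b : Polynomial ℚ}
    (hb : IsOperatorFamily cusp fun m => MvPolynomial.C (Polynomial.eval (m : ℚ) b) * cusp ^ m)
    {u v : ℚ} (h : IsRootPair u v) : b.eval (u + v) = 0 := by
  obtain ⟨H, hH, N, hN⟩ := hb.hasVanishingCoeff
  have heval (x : Fin 2 → ℚ) : MvPolynomial.eval x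
      (Polynomial.aeval (MvPolynomial.X 0 + MvPolynomial.X 1) b) = b.eval (x 0 + x 1) := by
    simp [eval_polynomial_aeval]
  have hinf : (((↑) : ℕ → ℚ) '' Set.Ici N).Infinite :=
    (Set.Ici_infinite N).image Nat.cast_injective.injOn
  have key : Polynomial.aeval (MvPolynomial.X 0 + MvPolynomial.X 1) b = H := by
    refine MvPolynomial.funext_set (fun _ => ((↑) : ℕ → ℚ) '' Set.Ici N) (fun _ => hinf)
      fun x hx => ?_
    obtain ⟨i, hi, hxi⟩ := hx 0 trivial
    obtain ⟨j, hj, hxj⟩ := hx 1 trivial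
    have hx' : x = ![(i : ℚ), (j : ℚ)] := by
      ext l
      fin_cases l <;> simp [hxi, hxj]
    have := hN i j hi hj
    beta_reduce at this
    rw [cusp_pow, MvPolynomial.coeff_C_mul, coeff_expo_form, mul_comm] at this
    have := mul_left_cancel₀
      (Nat.cast_ne_zero.2 (Nat.choose_pos (Nat.le_add_right i j)).ne') this
    rw [heval, hx', ← this]
    simp
  rw [← hH u v h, ← key, heval]
  rfl

lemma satisfiesBS_cusp_iff (b : Polynomial ℚ) : SatisfiesBS cusp 1 b ↔ cuspBS ∣ b := by
  rw [satisfiesBS_one_iff]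
  constructor
  · intro hb
    have hroot {u v c : ℚ} (h : IsRootPair u v) (hc : u + v = -c) :
        Polynomial.X + Polynomial.C c ∣ b := by
      rw [← sub_neg_eq_add, ← map_neg, Polynomial.dvd_iff_isRoot, Polynomial.IsRoot, ← hc]
      exact isRoot_of_isRootPair hb h
    have hcop {c d : ℚ} (h : c ≠ d) :
        IsCoprime (Polynomial.X + Polynomial.C c) (Polynomial.X + Polynomial.C d) := by
      simpa using Polynomial.isCoprime_X_sub_C_of_isUnit_sub (a := -c) (b := -d)
        (by simpa [sub_eq_zero, neg_add_eq_zero] using h)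
    rw [cuspBS]
    refine IsCoprime.mul_dvd ?_ (IsCoprime.mul_dvd ?_ (IsCoprime.mul_dvd ?_ (IsCoprime.mul_dvd ?_
      (IsCoprime.mul_dvd ?_ (IsCoprime.mul_dvd ?_
        (hroot (u := -1 / 2) (v := -1 / 3) (by norm_num [IsRootPair]) (by norm_num))
        (hroot (u := 0) (v := -1) (by norm_num [IsRootPair]) (by norm_num)))
        (hroot (u := -1 / 2) (v := -2 / 3) (by norm_num [IsRootPair]) (by norm_num)))
        (hroot (u := -1) (v := -1 / 3) (by norm_num [IsRootPair]) (by norm_num)))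
        (hroot (u := -1 / 2) (v := -1) (by norm_num [IsRootPair]) (by norm_num)))
        (hroot (u := -1) (v := -2 / 3) (by norm_num [IsRootPair]) (by norm_num)))
        (hroot (u := -1) (v := -1) (by norm_num [IsRootPair]) (by norm_num))
    all_goals
      try simp only [IsCoprime.mul_left_iff]
      (repeat' apply And.intro) <;> exact hcop (by norm_num)
  · rintro ⟨c, rfl⟩
    refine (congrArg (IsOperatorFamily cusp) (funext fun m => ?_)).mp
      (isOperatorFamily_cuspBS.eval_mul (c.map MvPolynomial.C))
    rw [Polynomial.eval_mul, map_mul, ← map_natCast (MvPolynomial.C (σ := Fin 4) (R := ℚ)),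
      Polynomial.eval_map_apply]
    ring

end BernsteinSato

theorem bernsteinSato_stmt_8 :
    ∀ b : Polynomial ℚ,
      SatisfiesBS (X 2 * (X 0) ^ 2 + X 3 * (X 1) ^ 3 : MvPolynomial (Fin 4) ℚ)
          (1) b ↔
        (Polynomial.X + Polynomial.C (5 / 6 : ℚ)) *
            (Polynomial.X + Polynomial.C (1 : ℚ)) *
            (Polynomial.X + Polynomial.C (7 / 6 : ℚ)) *
            (Polynomial.X + Polynomial.C (4 / 3 : ℚ)) *
            (Polynomial.X + Polynomial.C (3 / 2 : ℚ)) *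
            (Polynomial.X + Polynomial.C (5 / 3 : ℚ)) *
            (Polynomial.X + Polynomial.C (2 : ℚ)) ∣ b :=
  BernsteinSato.satisfiesBS_cusp_iff
end
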